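/- arXiv:1410.3031 — 2 statements merged into one kernel-verified Lean document; each statement's English description precedes it below -/
import Mathlib

section
/- Lower bound for quantum state redistribution: Let ε > 0 and let Ψ_RABC be a pure state on R×A×B×C. Suppose given finite nonempty index types S_A, S_B, M, T_A, T_B with |C|·|S_A| = |M|·|T_A| and |S_B|·|M| = |C|·|T_B|; a unit vector θ on S_A×S_B; a unitary matrix U : Matrix (M×T_A) (C×S_A) ℂ (i.e. U·U† and U†·U are identities); and a unitary matrix V : Matrix (B×C×T_B) (B×S_B×M) ℂ. Let Φ be the density matrix on R×A×B×C×T_A×T_B obtained from |Ψ⟩⟨Ψ| ⊗ |θ⟩⟨θ| by first applying U on the factors C×S_A (tensored with the identity on the remaining factors), producing factors M×T_A, and then applying V on the factors B×S_B×M (tensored with the identity on the remaining factors), producing factors B×C×T_B, with the resulting factors reordered as R×A×B×C×T_A×T_B. If the marginal Φ_RABC lies in B^ε(|Ψ⟩⟨Ψ|_RABC), then log|M| ≥ (1/2)·Q^ε(Ψ_RABC). -/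
open scoped Kronecker BigOperators
open Matrix
open scoped ComplexOrder Classical

noncomputable section

/-- A density matrix: positive semidefinite with unit trace. -/
def IsDensityMatrix {d : Type*} [Fintype d] (ρ : Matrix d d ℂ) : Prop :=
  ρ.PosSemidef ∧ ρ.trace = 1

/-- Loewner order on Hermitian matrices: `A ≤ B` iff `B - A` is positive semidefinite. -/
def LoewnerLE {d : Type*} [Fintype d] (A B : Matrix d d ℂ) : Prop := (B - A).PosSemidef

/-- Partial trace over the second tensor factor. -/
def ptrace2 {d₁ d₂ : Type*} [Fintype d₂] (M : Matrix (d₁ × d₂) (d₁ × d₂) ℂ) :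
    Matrix d₁ d₁ ℂ :=
  fun i i' => ∑ k, M (i, k) (i', k)

/-- Partial trace over the first tensor factor. -/
def ptrace1 {d₁ d₂ : Type*} [Fintype d₁] (M : Matrix (d₁ × d₂) (d₁ × d₂) ℂ) :
    Matrix d₂ d₂ ℂ :=
  fun j j' => ∑ k, M (k, j) (k, j')

/-- Functional calculus for Hermitian matrices: apply `f` to the eigenvalues. -/
def hermCFC {d : Type*} [Fintype d] [DecidableEq d] (f : ℝ → ℝ) (A : Matrix d d ℂ) :
    Matrix d d ℂ :=
  if hA : A.IsHermitian then
    (hA.eigenvectorUnitary : Matrix d d ℂ) *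
      Matrix.diagonal (fun i => (f (hA.eigenvalues i) : ℂ)) *
      (star (hA.eigenvectorUnitary : Matrix d d ℂ))
  else 0

/-- Matrix logarithm, base 2, applied to nonzero eigenvalues. -/
def matLog2 {d : Type*} [Fintype d] [DecidableEq d] (A : Matrix d d ℂ) : Matrix d d ℂ :=
  hermCFC (Real.logb 2) A

/-- Positive semidefinite square root (via functional calculus). -/
def matSqrt {d : Type*} [Fintype d] [DecidableEq d] (A : Matrix d d ℂ) : Matrix d d ℂ :=
  hermCFC Real.sqrt A

/-- Support containment: the kernel of `σ` is contained in the kernel of `ρ`. -/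
def SupportLE {d : Type*} [Fintype d] (ρ σ : Matrix d d ℂ) : Prop :=
  ∀ v : d → ℂ, σ.mulVec v = 0 → ρ.mulVec v = 0

/-- Relative entropy, base 2, as a real number (meaningful when supports are nested). -/
def relentR {d : Type*} [Fintype d] [DecidableEq d] (ρ σ : Matrix d d ℂ) : ℝ :=
  ((ρ * matLog2 ρ).trace - (ρ * matLog2 σ).trace).re

/-- Relative entropy `D(ρ‖σ)`, base 2, valued in the extended reals: `+∞` unless
the support of `ρ` is contained in the support of `σ`. -/
def relent {d : Type*} [Fintype d] [DecidableEq d] (ρ σ : Matrix d d ℂ) : EReal :=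
  if SupportLE ρ σ then ((relentR ρ σ : ℝ) : EReal) else ⊤

/-- Mutual information `I(A:B)_ρ = D(ρ_AB ‖ ρ_A ⊗ ρ_B)`. -/
def mutInfo {d₁ d₂ : Type*} [Fintype d₁] [Fintype d₂] [DecidableEq d₁] [DecidableEq d₂]
    (ρ : Matrix (d₁ × d₂) (d₁ × d₂) ℂ) : EReal :=
  relent ρ (ptrace2 ρ ⊗ₖ ptrace1 ρ)

/-- Fidelity `F(ρ,σ) = Tr √(√σ ρ √σ)`. -/
def fidelity {d : Type*} [Fintype d] [DecidableEq d] (ρ σ : Matrix d d ℂ) : ℝ :=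
  ((matSqrt (matSqrt σ * ρ * matSqrt σ)).trace).re

/-- Purified distance `P(ρ,σ) = √(1 - F(ρ,σ)²)`. -/
def pdist {d : Type*} [Fintype d] [DecidableEq d] (ρ σ : Matrix d d ℂ) : ℝ :=
  Real.sqrt (1 - (fidelity ρ σ) ^ 2)

/-- Max-relative entropy `Dmax(ρ‖σ) = inf {λ : ρ ≤ 2^λ σ}`, valued in the extended reals. -/
def dmax {d : Type*} [Fintype d] (ρ σ : Matrix d d ℂ) : EReal :=
  sInf {x : EReal | ∃ l : ℝ, x = (l : EReal) ∧ LoewnerLE ρ (((2 : ℝ) ^ l) • σ)}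

/-- Max-information `Imax(A:B)_ρ`. -/
def imax {d₁ d₂ : Type*} [Fintype d₁] [Fintype d₂]
    (ρ : Matrix (d₁ × d₂) (d₁ × d₂) ℂ) : EReal :=
  ⨅ σ : {σ : Matrix d₂ d₂ ℂ // IsDensityMatrix σ}, dmax ρ (ptrace2 ρ ⊗ₖ σ.1)

/-- Smooth max-information `Imax^ε(A:B)_ρ`. -/
def imaxEps {d₁ d₂ : Type*} [Fintype d₁] [Fintype d₂] [DecidableEq d₁] [DecidableEq d₂]
    (ε : ℝ) (ρ : Matrix (d₁ × d₂) (d₁ × d₂) ℂ) : EReal :=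
  ⨅ ρ' : {ρ' : Matrix (d₁ × d₂) (d₁ × d₂) ℂ // IsDensityMatrix ρ' ∧ pdist ρ ρ' ≤ ε},
    imax ρ'.1

/-- The `j`-th term of the convex split: `ρ` on `P` and the `j`-th copy of `Q`, and
`σ` on every other copy of `Q`. -/
def blockState {P Q : Type*} [Fintype Q] [DecidableEq Q]
    (ρ : Matrix (P × Q) (P × Q) ℂ) (σ : Matrix Q Q ℂ) (n : ℕ) (j : Fin n) :
    Matrix (P × (Fin n → Q)) (P × (Fin n → Q)) ℂ :=
  fun x y => ρ (x.1, x.2 j) (y.1, y.2 j) * ∏ i ∈ Finset.univ.erase j, σ (x.2 i) (y.2 i)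

/-- The convex-split state `τ = (1/n) Σ_j ρ_{PQ_j} ⊗ σ_{Q_1} ⊗ ⋯ ⊗ σ_{Q_n}` (omitting `j`). -/
def convexSplit {P Q : Type*} [Fintype Q] [DecidableEq Q]
    (ρ : Matrix (P × Q) (P × Q) ℂ) (σ : Matrix Q Q ℂ) (n : ℕ) :
    Matrix (P × (Fin n → Q)) (P × (Fin n → Q)) ℂ :=
  ((n : ℂ)⁻¹) • ∑ j : Fin n, blockState ρ σ n j

/-- A finite nonempty index type. -/
structure FinIdx where
  carrier : Type
  [fin : Fintype carrier]
  [deq : DecidableEq carrier]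
  [ne : Nonempty carrier]

attribute [instance] FinIdx.fin FinIdx.deq FinIdx.ne

section Qeps

variable {R A B C : Type} [Fintype R] [Fintype A] [Fintype B] [Fintype C]
  [DecidableEq R] [DecidableEq A] [DecidableEq B] [DecidableEq C]

/-- Reindexing `(R×B)×(C×T) ≃ R×((B×C)×T)`. -/
def eRBCT (R B C T : Type) : (R × B) × (C × T) ≃ R × ((B × C) × T) :=
  (Equiv.prodAssoc R B (C × T)).trans
    (Equiv.prodCongr (Equiv.refl R) (Equiv.prodAssoc B C T).symm)

/-- The quantity `Q^ε(Ψ_RABC)` from Anshu–Devabathini–Jain: the infimum, over finite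
nonempty index types `T`, unitaries `U` on `B×C×T`, density matrices `σ'` on `T`,
density matrices `σCT` on `C×T`, and density matrices `κ` on `(R×B)×(C×T)` with
`κ_RB = Ψ_RB` and `(1⊗U)·κ·(1⊗U)† ∈ B^ε(Ψ_RBC ⊗ σ')`, of `Dmax(κ ‖ κ_RB ⊗ σCT)`.
Here `ψ` is a unit vector on `(R×(B×C))×A` describing the pure state `Ψ_RABC`. -/
def Qeps (ε : ℝ) (ψ : (R × (B × C)) × A → ℂ) : EReal :=
  ⨅ (T : FinIdx)
    (U : Matrix.unitaryGroup ((B × C) × T.carrier) ℂ)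
    (σ' : {m : Matrix T.carrier T.carrier ℂ // IsDensityMatrix m})
    (σCT : {m : Matrix (C × T.carrier) (C × T.carrier) ℂ // IsDensityMatrix m})
    (κ : {m : Matrix ((R × B) × (C × T.carrier)) ((R × B) × (C × T.carrier)) ℂ //
            IsDensityMatrix m})
    (_ : ptrace2 κ.1 =
          ptrace2 (Matrix.reindex (Equiv.prodAssoc R B C).symm (Equiv.prodAssoc R B C).symm
            (ptrace2 (Matrix.vecMulVec ψ (star ψ)))))
    (_ : IsDensityMatrix
            (((1 : Matrix R R ℂ) ⊗ₖ U.1) *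
              (Matrix.reindex (eRBCT R B C T.carrier) (eRBCT R B C T.carrier) κ.1) *
              ((1 : Matrix R R ℂ) ⊗ₖ U.1)ᴴ) ∧
         pdist
            (Matrix.reindex (Equiv.prodAssoc R (B × C) T.carrier)
              (Equiv.prodAssoc R (B × C) T.carrier)
              ((ptrace2 (Matrix.vecMulVec ψ (star ψ))) ⊗ₖ σ'.1))
            (((1 : Matrix R R ℂ) ⊗ₖ U.1) *
              (Matrix.reindex (eRBCT R B C T.carrier) (eRBCT R B C T.carrier) κ.1) *
              ((1 : Matrix R R ℂ) ⊗ₖ U.1)ᴴ) ≤ ε),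
    dmax κ.1 (ptrace2 κ.1 ⊗ₖ σCT.1)

end Qeps

section Protocol

variable {R A B C SA SB M TA TB : Type}
  [Fintype R] [Fintype A] [Fintype B] [Fintype C] [Fintype SA] [Fintype SB]
  [Fintype M] [Fintype TA] [Fintype TB]

/-- The global pure state after Alice applies the unitary `U` on her registers `C × SA`
(producing `M × TA`), starting from `Ψ_RABC ⊗ θ_{SA,SB}`. -/
def stepU (ψ : (R × (B × C)) × A → ℂ) (θ : SA × SB → ℂ)
    (U : Matrix (M × TA) (C × SA) ℂ) :
    (R × A × B × SB) × (M × TA) → ℂ :=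
  fun x => ∑ cs : C × SA,
    U x.2 cs * ψ ((x.1.1, (x.1.2.2.1, cs.1)), x.1.2.1) * θ (cs.2, x.1.2.2.2)

/-- The global pure state after Bob additionally applies the unitary `V` on his
registers `B × SB × M` (producing `B × C × TB`). -/
def stepV (ψ : (R × (B × C)) × A → ℂ) (θ : SA × SB → ℂ)
    (U : Matrix (M × TA) (C × SA) ℂ) (V : Matrix (B × (C × TB)) (B × (SB × M)) ℂ) :
    (R × A × TA) × (B × (C × TB)) → ℂ :=
  fun y => ∑ x : B × (SB × M),
    V y.2 x * stepU ψ θ U ((y.1.1, y.1.2.1, x.1, x.2.1), (x.2.2, y.1.2.2))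

/-- The final global pure state, with factors reordered as
`((R × (B × C)) × A) × (TA × TB)`. -/
def finalVec (ψ : (R × (B × C)) × A → ℂ) (θ : SA × SB → ℂ)
    (U : Matrix (M × TA) (C × SA) ℂ) (V : Matrix (B × (C × TB)) (B × (SB × M)) ℂ) :
    ((R × (B × C)) × A) × (TA × TB) → ℂ :=
  fun z => stepV ψ θ U V
    ((z.1.1.1, z.1.2, z.2.1), (z.1.1.2.1, (z.1.1.2.2, z.2.2)))

end Protocol

lemma hermCFC_eq {d : Type*} [Fintype d] [DecidableEq d] {A : Matrix d d ℂ} (hA : A.IsHermitian)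
    (f : ℝ → ℝ) :
    hermCFC f A = (hA.eigenvectorUnitary : Matrix d d ℂ) *
      diagonal (fun i => (f (hA.eigenvalues i) : ℂ)) *
      star (hA.eigenvectorUnitary : Matrix d d ℂ) := by
  rw [hermCFC, dif_pos hA]

lemma hermCFC_mul {d : Type*} [Fintype d] [DecidableEq d] {A : Matrix d d ℂ}
    (hA : A.IsHermitian) (f g : ℝ → ℝ) :
    hermCFC f A * hermCFC g A = hermCFC (fun x => f x * g x) A := by
  have h : star (hA.eigenvectorUnitary : Matrix d d ℂ) * (hA.eigenvectorUnitary : Matrix d d ℂ)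
      = 1 := Unitary.coe_star_mul_self _
  simp only [hermCFC_eq hA]
  calc _ = (hA.eigenvectorUnitary : Matrix d d ℂ) *
        (diagonal (fun i => (f (hA.eigenvalues i) : ℂ)) *
        (star (hA.eigenvectorUnitary : Matrix d d ℂ) * (hA.eigenvectorUnitary : Matrix d d ℂ)) *
        diagonal (fun i => (g (hA.eigenvalues i) : ℂ))) *
        star (hA.eigenvectorUnitary : Matrix d d ℂ) := by simp only [Matrix.mul_assoc]
    _ = _ := by
      rw [h, Matrix.mul_one, diagonal_mul_diagonal]
      simp only [Complex.ofReal_mul]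

lemma hermCFC_congr {d : Type*} [Fintype d] [DecidableEq d] {A : Matrix d d ℂ}
    (hA : A.IsHermitian) {f g : ℝ → ℝ} (h : ∀ i, f (hA.eigenvalues i) = g (hA.eigenvalues i)) :
    hermCFC f A = hermCFC g A := by
  simp only [hermCFC_eq hA, h]

lemma hermCFC_id {d : Type*} [Fintype d] [DecidableEq d] {A : Matrix d d ℂ}
    (hA : A.IsHermitian) : hermCFC (fun x => x) A = A := by
  rw [hermCFC_eq hA]
  exact hA.spectral_theorem.symm

lemma hermCFC_posSemidef {d : Type*} [Fintype d] [DecidableEq d] {A : Matrix d d ℂ}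
    (hA : A.IsHermitian) {f : ℝ → ℝ} (hf : ∀ x, 0 ≤ f x) : (hermCFC f A).PosSemidef := by
  rw [hermCFC_eq hA]
  refine PosSemidef.mul_mul_conjTranspose_same (posSemidef_diagonal_iff.2 fun i => ?_) _
  exact_mod_cast hf _

lemma matSqrt_posSemidef {d : Type*} [Fintype d] [DecidableEq d] {A : Matrix d d ℂ}
    (hA : A.PosSemidef) : (matSqrt A).PosSemidef :=
  hermCFC_posSemidef hA.1 Real.sqrt_nonneg

lemma matSqrt_mul_self {d : Type*} [Fintype d] [DecidableEq d] {A : Matrix d d ℂ}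
    (hA : A.PosSemidef) : matSqrt A * matSqrt A = A := by
  rw [matSqrt, hermCFC_mul hA.1]
  refine (hermCFC_congr hA.1 fun i => ?_).trans (hermCFC_id hA.1)
  exact Real.mul_self_sqrt (hA.eigenvalues_nonneg i)

/-- Left polar decomposition: `Y = √(Y Yᴴ) W` with `W` a contraction. -/
lemma exists_polar {d k : Type*} [Fintype d] [DecidableEq d] [Fintype k] (Y : Matrix d k ℂ) :
    ∃ W : Matrix d k ℂ, Y = matSqrt (Y * Yᴴ) * W ∧ (1 - W * Wᴴ).PosSemidef := by
  have hA : (Y * Yᴴ).PosSemidef := posSemidef_self_mul_conjTranspose Y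
  set A := Y * Yᴴ with hAdef
  set S := matSqrt A with hS
  set T := hermCFC (fun x => (√x)⁻¹) A with hT
  set P := S * T with hP
  have hTh : Tᴴ = T := (hermCFC_posSemidef hA.1 fun x => inv_nonneg.2 (Real.sqrt_nonneg x)).1
  have hP' : P = hermCFC (fun x => √x * (√x)⁻¹) A := hermCFC_mul hA.1 _ _
  have hPh : Pᴴ = P := by
    rw [hP']
    exact (hermCFC_posSemidef hA.1 fun x =>
      mul_nonneg (Real.sqrt_nonneg x) (inv_nonneg.2 (Real.sqrt_nonneg x))).1
  have hPA : P * A = A := by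
    have h1 : P * hermCFC (fun x => x) A = hermCFC (fun x => x) A := by
      rw [hP', hermCFC_mul hA.1]
      refine hermCFC_congr hA.1 fun i => ?_
      rcases (hA.eigenvalues_nonneg i).eq_or_lt with h | h
      · simp [← h]
      · rw [mul_inv_cancel₀ (Real.sqrt_pos.2 h).ne', one_mul]
    simpa only [hermCFC_id hA.1] using h1
  have hPP : P * P = P := by
    rw [hP', hermCFC_mul hA.1]
    refine hermCFC_congr hA.1 fun i => ?_
    by_cases h : √(hA.1.eigenvalues i) = 0
    · simp [h]
    · simp [h]
  have hTAT : T * A * T = P := by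
    have h1 : hermCFC (fun x => (√x)⁻¹) A * hermCFC (fun x => x) A * hermCFC (fun x => (√x)⁻¹) A =
        P := by
      rw [hP', hermCFC_mul hA.1, hermCFC_mul hA.1]
      refine hermCFC_congr hA.1 fun i => ?_
      rcases (hA.eigenvalues_nonneg i).eq_or_lt with h | h
      · simp [← h]
      · have h2 := Real.mul_self_sqrt h.le
        have h3 := (Real.sqrt_pos.2 h).ne'
        field_simp
        rw [sq]; exact h2.symm
    simpa only [hermCFC_id hA.1] using h1
  have hPY : (1 - P) * Y = 0 := by
    rw [← self_mul_conjTranspose_eq_zero, conjTranspose_mul]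
    calc _ = (1 - P) * A * (1 - P)ᴴ := by simp only [hAdef, Matrix.mul_assoc]
      _ = 0 := by rw [Matrix.sub_mul, hPA, Matrix.one_mul, sub_self, Matrix.zero_mul]
  refine ⟨T * Y, ?_, ?_⟩
  · rw [← Matrix.mul_assoc, ← hP]
    rwa [Matrix.sub_mul, Matrix.one_mul, sub_eq_zero] at hPY
  · have h1 : T * Y * (T * Y)ᴴ = P := by
      rw [conjTranspose_mul, hTh, ← hTAT]
      simp only [hAdef, Matrix.mul_assoc]
    have h2 : (1 - P) * (1 - P)ᴴ = 1 - P := by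
      rw [conjTranspose_sub, conjTranspose_one, hPh, Matrix.mul_sub, Matrix.mul_one,
        Matrix.sub_mul, Matrix.one_mul, hPP, sub_self, sub_zero]
    rw [h1, ← h2]
    exact posSemidef_self_mul_conjTranspose _

lemma re_trace_conj_le {d k : Type*} [Fintype d] [DecidableEq d] [Fintype k]
    {P : Matrix d d ℂ} (hP : P.PosSemidef) {W : Matrix d k ℂ} (hW : (1 - W * Wᴴ).PosSemidef) :
    (Wᴴ * P * W).trace.re ≤ P.trace.re := by
  have h := (hW.conjTranspose_mul_mul_same (matSqrt P)).trace_nonneg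
  have h1 : ((matSqrt P)ᴴ * (1 - W * Wᴴ) * matSqrt P).trace = P.trace - (Wᴴ * P * W).trace := by
    rw [(matSqrt_posSemidef hP).1.eq, Matrix.mul_sub, Matrix.sub_mul, trace_sub, Matrix.mul_one,
      matSqrt_mul_self hP]
    congr 1
    rw [Matrix.trace_mul_comm, ← Matrix.mul_assoc, matSqrt_mul_self hP, ← Matrix.mul_assoc,
      Matrix.trace_mul_comm, Matrix.mul_assoc]
  rw [h1] at h
  have := (Complex.le_def.1 h).1
  simpa using this

/-- The easy direction of Uhlmann's theorem: the overlap of purifications is at most the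
fidelity. -/
lemma re_trace_le_fidelity {d k : Type*} [Fintype d] [DecidableEq d] [Fintype k]
    (X Y : Matrix d k ℂ) : (Yᴴ * X).trace.re ≤ fidelity (X * Xᴴ) (Y * Yᴴ) := by
  obtain ⟨W, hW, hW1⟩ := exists_polar Y
  have hS := matSqrt_posSemidef (posSemidef_self_mul_conjTranspose Y)
  rw [fidelity]
  set S := matSqrt (Y * Yᴴ) with hSdef
  obtain ⟨Q, hQ, hQ1⟩ := exists_polar (S * X)
  have hP := matSqrt_posSemidef (posSemidef_self_mul_conjTranspose (S * X))
  have hN : S * X * (S * X)ᴴ = S * (X * Xᴴ) * S := by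
    rw [conjTranspose_mul, hS.1.eq]; simp only [Matrix.mul_assoc]
  rw [hN] at hQ hP
  set P := matSqrt (S * (X * Xᴴ) * S) with hPdef
  have h1 : Yᴴ * X = Wᴴ * P * Q := by
    conv_lhs => rw [hW]
    rw [conjTranspose_mul, hS.1.eq, Matrix.mul_assoc, hQ, Matrix.mul_assoc]
  have h2 : (Qᴴ * P * W).trace.re = (Wᴴ * P * Q).trace.re := by
    have : Qᴴ * P * W = (Wᴴ * P * Q)ᴴ := by
      simp only [conjTranspose_mul, conjTranspose_conjTranspose, hP.1.eq, Matrix.mul_assoc]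
    rw [this, trace_conjTranspose]
    simp
  have h3 := (Complex.le_def.1 (hP.conjTranspose_mul_mul_same (W - Q)).trace_nonneg).1
  have h4 : (W - Q)ᴴ * P * (W - Q) =
      Wᴴ * P * W - Wᴴ * P * Q - (Qᴴ * P * W - Qᴴ * P * Q) := by
    simp only [conjTranspose_sub, Matrix.sub_mul, Matrix.mul_sub]
    abel
  rw [h4] at h3
  simp only [trace_sub, Complex.sub_re, Complex.zero_re, h2] at h3
  have h5 := re_trace_conj_le hP hW1
  have h6 := re_trace_conj_le hP hQ1
  rw [h1]
  linarith

open scoped MatrixOrder in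
lemma posSemidef_eq_of_mul_self_eq {d : Type*} [Fintype d] [DecidableEq d] {A B : Matrix d d ℂ}
    (hA : A.PosSemidef) (hB : B.PosSemidef) (h : A * A = B * B) : A = B := by
  have h1 := CFC.sqrt_unique (a := B * B) h (nonneg_iff_posSemidef.2 hA)
  have h2 := CFC.sqrt_unique (a := B * B) rfl (nonneg_iff_posSemidef.2 hB)
  rw [← h1, h2]

lemma matSqrt_vecMulVec {d : Type*} [Fintype d] [DecidableEq d] (v : d → ℂ) :
    matSqrt (vecMulVec v (star v)) = (((√(∑ i, ‖v i‖ ^ 2))⁻¹ : ℝ) : ℂ) • vecMulVec v (star v) := by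
  have hpsd := posSemidef_vecMulVec_self_star v
  refine posSemidef_eq_of_mul_self_eq (matSqrt_posSemidef hpsd) (hpsd.smul ?_) ?_
  · exact_mod_cast inv_nonneg.2 (Real.sqrt_nonneg _)
  · have hq : star v ⬝ᵥ v = ((∑ i, ‖v i‖ ^ 2 : ℝ) : ℂ) := by
      simp [dotProduct, Complex.conj_mul']
    have h0 : 0 ≤ ∑ i, ‖v i‖ ^ 2 := Finset.sum_nonneg fun i _ => sq_nonneg _
    rw [matSqrt_mul_self hpsd, Matrix.smul_mul, Matrix.mul_smul, smul_smul,
      vecMulVec_mul_vecMulVec, hq]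
    rcases h0.eq_or_lt with h | h
    · have hv : v = 0 := by
        funext i
        have := (Finset.sum_eq_zero_iff_of_nonneg fun i _ => sq_nonneg ‖v i‖).1 h.symm i
          (Finset.mem_univ i)
        simpa using this
      simp [hv]
    · have h2 : (√(∑ i, ‖v i‖ ^ 2))⁻¹ * (√(∑ i, ‖v i‖ ^ 2))⁻¹ * ∑ i, ‖v i‖ ^ 2 = 1 := by
        rw [← mul_inv, Real.mul_self_sqrt h0, inv_mul_cancel₀ h.ne']
      rw [vecMulVec_smul, smul_smul, ← Complex.ofReal_mul, ← Complex.ofReal_mul, h2,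
        Complex.ofReal_one, one_smul]

/-- The squared fidelity with a pure state is the expectation value in that state. -/
lemma fidelity_vecMulVec_sq {d : Type*} [Fintype d] [DecidableEq d] (v : d → ℂ)
    {ρ : Matrix d d ℂ} (hρ : ρ.PosSemidef) :
    fidelity (vecMulVec v (star v)) ρ ^ 2 = (star v ⬝ᵥ (ρ *ᵥ v)).re := by
  have hS := matSqrt_posSemidef hρ
  set S := matSqrt ρ with hSdef
  set w := S *ᵥ v with hw
  have hN : S * vecMulVec v (star v) * S = vecMulVec w (star w) := by
    rw [mul_vecMulVec, vecMulVec_mul, hw, star_mulVec, hS.1.eq]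
  have hww : star w ⬝ᵥ w = star v ⬝ᵥ (ρ *ᵥ v) := by
    rw [hw, star_mulVec, hS.1.eq, ← dotProduct_mulVec, mulVec_mulVec, hSdef, matSqrt_mul_self hρ]
  have hq : star w ⬝ᵥ w = ((∑ i, ‖w i‖ ^ 2 : ℝ) : ℂ) := by
    simp [dotProduct, Complex.conj_mul']
  have h0 : 0 ≤ ∑ i, ‖w i‖ ^ 2 := Finset.sum_nonneg fun i _ => sq_nonneg _
  rw [fidelity, ← hSdef, hN, matSqrt_vecMulVec, trace_smul, trace_vecMulVec, dotProduct_comm,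
    ← hww, hq, smul_eq_mul]
  rw [← Complex.ofReal_mul, Complex.ofReal_re, Complex.ofReal_re]
  rcases h0.eq_or_lt with h | h
  · simp [← h]
  · rw [mul_pow, inv_pow, Real.sq_sqrt h0]
    field_simp

lemma dotProduct_mulVec_self_mul_conjTranspose {d k : Type*} [Fintype d] [Fintype k]
    (Z : Matrix d k ℂ) (w : d → ℂ) :
    star w ⬝ᵥ ((Z * Zᴴ) *ᵥ w) = ((∑ k, ‖(Zᴴ *ᵥ w) k‖ ^ 2 : ℝ) : ℂ) := by
  rw [← mulVec_mulVec, dotProduct_mulVec, ← star_star (star w ᵥ* Z), star_vecMul, star_star]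
  simp [dotProduct, Complex.conj_mul']

/-- Tracing out `M` and replacing it by the maximally mixed state dominates the original state
up to a factor `|M|²`. -/
lemma posSemidef_card_smul_ptrace2_sub {X M K : Type*} [Fintype X] [Fintype M] [Fintype K]
    [DecidableEq M] (Z : Matrix (X × M) K ℂ) :
    ((Fintype.card M : ℂ) • (ptrace2 (Z * Zᴴ) ⊗ₖ (1 : Matrix M M ℂ)) - Z * Zᴴ).PosSemidef := by
  let Y : Matrix (X × M) (K × M × M) ℂ :=
    .of fun x k => if x.2 = k.2.1 then Z (x.1, k.2.2) k.1 else 0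
  have hY : ptrace2 (Z * Zᴴ) ⊗ₖ (1 : Matrix M M ℂ) = Y * Yᴴ := by
    ext ⟨x, m⟩ ⟨x', m'⟩
    simp only [kronecker_apply, ptrace2, mul_apply, conjTranspose_apply, one_apply, of_apply,
      Fintype.sum_prod_type, Y]
    rw [Finset.sum_comm]
    by_cases h : m = m'
    · subst h
      simp [apply_ite star]
    · simp only [h, if_false, mul_zero]
      symm
      refine Finset.sum_eq_zero fun k _ => Finset.sum_eq_zero fun a _ =>
        Finset.sum_eq_zero fun b _ => ?_
      by_cases h1 : m = a
      · simp [← h1, Ne.symm h]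
      · simp [h1]
  have hZ : ∀ (w : X × M → ℂ) (k : K), (Zᴴ *ᵥ w) k = ∑ m, (Yᴴ *ᵥ w) (k, m, m) := by
    intro w k
    simp only [mulVec, dotProduct, conjTranspose_apply, of_apply, Fintype.sum_prod_type, Y, apply_ite star,
      star_zero, ite_mul, zero_mul, Finset.sum_ite_eq', Finset.mem_univ, if_true]
    rw [Finset.sum_comm]
  rw [hY]
  have hpsd : ((Fintype.card M : ℂ) • (Y * Yᴴ)).PosSemidef :=
    (posSemidef_self_mul_conjTranspose Y).smul (Nat.cast_nonneg _)
  refine .of_dotProduct_mulVec_nonneg (hpsd.1.sub (posSemidef_self_mul_conjTranspose Z).1)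
    fun w => ?_
  rw [sub_mulVec, dotProduct_sub, smul_mulVec, dotProduct_smul,
    dotProduct_mulVec_self_mul_conjTranspose, dotProduct_mulVec_self_mul_conjTranspose, smul_eq_mul]
  rw [← Complex.ofReal_natCast, ← Complex.ofReal_mul, ← Complex.ofReal_sub, Complex.zero_le_real,
    sub_nonneg, Fintype.sum_prod_type, Finset.mul_sum]
  refine Finset.sum_le_sum fun k _ => ?_
  rw [hZ]
  calc ‖∑ m, (Yᴴ *ᵥ w) (k, m, m)‖ ^ 2 ≤ (∑ m, ‖(Yᴴ *ᵥ w) (k, m, m)‖) ^ 2 := by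
        gcongr; exact norm_sum_le _ _
    _ ≤ Fintype.card M * ∑ m, ‖(Yᴴ *ᵥ w) (k, m, m)‖ ^ 2 := by
        simpa using sq_sum_le_card_mul_sum_sq (s := Finset.univ)
          (f := fun m => ‖(Yᴴ *ᵥ w) (k, m, m)‖)
    _ ≤ _ := by
        rw [Fintype.sum_prod_type]
        gcongr with m
        exact Finset.single_le_sum (f := fun m' => ‖(Yᴴ *ᵥ w) (k, m, m')‖ ^ 2)
          (fun _ _ => sq_nonneg _) (Finset.mem_univ m)

/-- Uhlmann extension of a pure state: any purification `φ` of a state has an overlap with some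
product extension `ψ ⊗ ω` that attains the fidelity of the marginal with `ψ`. -/
lemma exists_product_extension {D E : Type*} [Fintype D] [DecidableEq D] [Fintype E] [Nonempty E]
    (ψ : D → ℂ) (φ : D × E → ℂ) :
    ∃ (ω : E → ℂ) (r : ℝ), ∑ e, ‖ω e‖ ^ 2 = 1 ∧ 0 ≤ r ∧
      fidelity (vecMulVec ψ (star ψ)) (ptrace2 (vecMulVec φ (star φ))) ^ 2 = r ^ 2 ∧
      ∑ d, ∑ e, star (φ (d, e)) * (ψ d * ω e) = r := by
  let Φ : Matrix D E ℂ := .of fun d e => φ (d, e)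
  have hΦ : ptrace2 (vecMulVec φ (star φ)) = Φ * Φᴴ := by
    ext d d'
    simp [ptrace2, vecMulVec_apply, mul_apply, Φ]
  let w : E → ℂ := Φᴴ *ᵥ ψ
  have hF : fidelity (vecMulVec ψ (star ψ)) (ptrace2 (vecMulVec φ (star φ))) ^ 2 =
      ∑ e, ‖w e‖ ^ 2 := by
    rw [hΦ, fidelity_vecMulVec_sq ψ (posSemidef_self_mul_conjTranspose Φ),
      dotProduct_mulVec_self_mul_conjTranspose, Complex.ofReal_re]
  have hsum : ∀ ω : E → ℂ, ∑ d, ∑ e, star (φ (d, e)) * (ψ d * ω e) = ∑ e, w e * ω e := by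
    intro ω
    rw [Finset.sum_comm]
    refine Finset.sum_congr rfl fun e _ => ?_
    simp only [w, mulVec, dotProduct, conjTranspose_apply, of_apply, Finset.sum_mul, mul_assoc, Φ]
  rw [hF]
  have h0 : 0 ≤ ∑ e, ‖w e‖ ^ 2 := Finset.sum_nonneg fun _ _ => sq_nonneg _
  rcases h0.eq_or_lt with h | h
  · obtain ⟨e₀⟩ := ‹Nonempty E›
    refine ⟨Pi.single e₀ 1, 0, ?_, le_rfl, by simp [← h], ?_⟩
    · rw [Finset.sum_eq_single e₀] <;> simp +contextual
    · have hw : ∀ e, w e = 0 := fun e => by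
        have := (Finset.sum_eq_zero_iff_of_nonneg fun i _ => sq_nonneg ‖w i‖).1 h.symm e
          (Finset.mem_univ e)
        simpa using this
      rw [hsum]
      simp [hw]
  · set r := √(∑ e, ‖w e‖ ^ 2) with hr
    have hr2 : r ^ 2 = ∑ e, ‖w e‖ ^ 2 := Real.sq_sqrt h0
    have hr0 : r ≠ 0 := (Real.sqrt_pos.2 h).ne'
    refine ⟨fun e => star (w e) / r, r, ?_, Real.sqrt_nonneg _, hr2.symm, ?_⟩
    · simp only [norm_div, norm_star, Complex.norm_real, Real.norm_eq_abs, div_pow, sq_abs]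
      rw [← Finset.sum_div, hr2, div_self h.ne']
    · rw [hsum]
      have h1 : ∀ e, w e * (star (w e) / r) = ((‖w e‖ ^ 2 / r : ℝ) : ℂ) := by
        intro e
        rw [← mul_div_assoc]
        push_cast
        rw [← Complex.mul_conj']
        rfl
      simp only [h1]
      rw [← Complex.ofReal_sum, ← Finset.sum_div, ← hr2, sq, mul_div_cancel_right₀ _ hr0]

lemma mulVec_dotProduct_star_mulVec {m n : Type*} [Fintype m] [Fintype n] [DecidableEq n]
    {U : Matrix m n ℂ} (hU : Uᴴ * U = 1) (v w : n → ℂ) :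
    (U *ᵥ v) ⬝ᵥ star (U *ᵥ w) = v ⬝ᵥ star w := by
  rw [star_mulVec, dotProduct_comm, ← dotProduct_mulVec, mulVec_mulVec, hU, one_mulVec,
    dotProduct_comm]

lemma trace_ptrace2 {d₁ d₂ : Type*} [Fintype d₁] [Fintype d₂]
    (N : Matrix (d₁ × d₂) (d₁ × d₂) ℂ) : (ptrace2 N).trace = N.trace := by
  simp only [trace, diag_apply, ptrace2, Fintype.sum_prod_type]

lemma trace_submatrix_equiv {m n : Type*} [Fintype m] [Fintype n] (N : Matrix m m ℂ)
    (e : n ≃ m) : (N.submatrix e e).trace = N.trace :=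
  e.sum_comp fun i => N i i

lemma trace_of_swap_mul_conjTranspose {m n : Type*} [Fintype m] [Fintype n] (θ : m × n → ℂ) :
    ((Matrix.of fun j i => θ (i, j)) * (Matrix.of fun j i => θ (i, j))ᴴ).trace =
      ((∑ x, ‖θ x‖ ^ 2 : ℝ) : ℂ) := by
  simp only [trace, diag_apply, mul_apply, conjTranspose_apply, of_apply, Fintype.sum_prod_type,
    Complex.ofReal_sum, Complex.ofReal_pow, ← Complex.mul_conj', ← starRingEnd_apply]
  exact Finset.sum_comm

lemma sum_regroup {R Q A TA TB : Type*} [Fintype R] [Fintype Q] [Fintype A] [Fintype TA]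
    [Fintype TB] (f : ((R × Q) × A) × (TA × TB) → ℂ) :
    ∑ k : A × TA, ∑ x : R × (Q × TB), f (((x.1, x.2.1), k.1), (k.2, x.2.2)) =
      ∑ d, ∑ e, f (d, e) := by
  rw [← Fintype.sum_prod_type' (f := fun (k : A × TA) (x : R × (Q × TB)) =>
    f (((x.1, x.2.1), k.1), (k.2, x.2.2))), ← Fintype.sum_prod_type]
  exact Fintype.sum_equiv
    ⟨fun z => (((z.2.1, z.2.2.1), z.1.1), (z.1.2, z.2.2.2)),
      fun z => ((z.1.2, z.2.1), (z.1.1.1, (z.1.1.2, z.2.2))), fun _ => rfl, fun _ => rfl⟩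
    _ _ fun _ => rfl

section Protocol

variable {R A B C SA SB M TA : Type}
  [Fintype A] [Fintype C] [Fintype SA] [Fintype M] [Fintype TA]

/-- The state after Alice's operation, as a matrix from her remaining registers `A × TA` to
all the others. -/
def aliceMatrix (ψ : (R × (B × C)) × A → ℂ) (θ : SA × SB → ℂ) (U : Matrix (M × TA) (C × SA) ℂ) :
    Matrix (((R × B) × SB) × M) (A × TA) ℂ :=
  .of fun x k => stepU ψ θ U ((x.1.1.1, k.1, x.1.1.2, x.1.2), (x.2, k.2))

lemma ptrace2_aliceMatrix [DecidableEq C] [DecidableEq SA]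
    (ψ : (R × (B × C)) × A → ℂ) (θ : SA × SB → ℂ)
    {U : Matrix (M × TA) (C × SA) ℂ} (hU : Uᴴ * U = 1) :
    ptrace2 (aliceMatrix ψ θ U * (aliceMatrix ψ θ U)ᴴ) =
      ptrace2 (Matrix.reindex (Equiv.prodAssoc R B C).symm (Equiv.prodAssoc R B C).symm
        (ptrace2 (Matrix.vecMulVec ψ (star ψ)))) ⊗ₖ
      ((Matrix.of fun s a => θ (a, s)) * (Matrix.of fun s a => θ (a, s))ᴴ) := by
  ext ⟨⟨r, b⟩, s⟩ ⟨⟨r', b'⟩, s'⟩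
  let v : R → B → SB → A → C × SA → ℂ :=
    fun r b s a cs => ψ ((r, (b, cs.1)), a) * θ (cs.2, s)
  have hstep : ∀ r a b s x, stepU ψ θ U ((r, a, b, s), x) = (U *ᵥ v r b s a) x := by
    intro r a b s x
    simp only [stepU, mulVec, dotProduct, v, mul_assoc]
  calc _ = ∑ a, (U *ᵥ v r b s a) ⬝ᵥ star (U *ᵥ v r' b' s' a) := by
        simp only [ptrace2, mul_apply, conjTranspose_apply, aliceMatrix, of_apply, hstep,
          Fintype.sum_prod_type, dotProduct, Pi.star_apply]
        exact Finset.sum_comm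
    _ = ∑ a, ∑ c, ∑ t, (ψ ((r, (b, c)), a) * star (ψ ((r', (b', c)), a))) *
          (θ (t, s) * star (θ (t, s'))) := by
        refine Finset.sum_congr rfl fun a _ => ?_
        rw [mulVec_dotProduct_star_mulVec hU, dotProduct, Fintype.sum_prod_type]
        refine Finset.sum_congr rfl fun c _ => Finset.sum_congr rfl fun t _ => ?_
        simp only [v, Pi.star_apply, star_mul']
        ring
    _ = _ := by
        simp only [ptrace2, kronecker_apply, reindex_apply, submatrix_apply, vecMulVec_apply,
          mul_apply, conjTranspose_apply, of_apply, Equiv.symm_symm, Equiv.prodAssoc_apply,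
          Pi.star_apply, ← Finset.mul_sum, ← Finset.sum_mul]
        rw [Finset.sum_comm]

end Protocol

section Qeps

variable {R A B C : Type} [Fintype R] [Fintype A] [Fintype B] [Fintype C]
  [DecidableEq R] [DecidableEq B] [DecidableEq C]

lemma dmax_le {d : Type*} [Fintype d] {ρ σ : Matrix d d ℂ} {l : ℝ}
    (h : LoewnerLE ρ (((2 : ℝ) ^ l) • σ)) : dmax ρ σ ≤ l :=
  sInf_le ⟨l, rfl, h⟩

lemma Qeps_le (ε : ℝ) (ψ : (R × (B × C)) × A → ℂ) {T : Type} [Fintype T] [DecidableEq T]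
    [Nonempty T] {W : Matrix ((B × C) × T) ((B × C) × T) ℂ} (hW : W ∈ unitaryGroup _ ℂ)
    {σ' : Matrix T T ℂ} (hσ' : IsDensityMatrix σ')
    {σ : Matrix (C × T) (C × T) ℂ} (hσ : IsDensityMatrix σ)
    {κ : Matrix ((R × B) × (C × T)) ((R × B) × (C × T)) ℂ} (hκ : IsDensityMatrix κ)
    (hκRB : ptrace2 κ = ptrace2 (Matrix.reindex (Equiv.prodAssoc R B C).symm
      (Equiv.prodAssoc R B C).symm (ptrace2 (Matrix.vecMulVec ψ (star ψ)))))
    {Y X : Matrix (R × ((B × C) × T)) (R × ((B × C) × T)) ℂ}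
    (hY : ((1 : Matrix R R ℂ) ⊗ₖ W) * (Matrix.reindex (eRBCT R B C T) (eRBCT R B C T) κ) *
      ((1 : Matrix R R ℂ) ⊗ₖ W)ᴴ = Y) (hYd : IsDensityMatrix Y)
    (hX : Matrix.reindex (Equiv.prodAssoc R (B × C) T) (Equiv.prodAssoc R (B × C) T)
      (ptrace2 (Matrix.vecMulVec ψ (star ψ)) ⊗ₖ σ') = X)
    (hXY : pdist X Y ≤ ε) :
    Qeps ε ψ ≤ dmax κ (ptrace2 κ ⊗ₖ σ) := by
  subst hX hY
  exact iInf_le_of_le ⟨T⟩ <| iInf_le_of_le ⟨W, hW⟩ <| iInf_le_of_le ⟨σ', hσ'⟩ <|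
    iInf_le_of_le ⟨σ, hσ⟩ <| iInf_le_of_le ⟨κ, hκ⟩ <| iInf_le_of_le hκRB <|
    iInf_le_of_le ⟨hYd, hXY⟩ le_rfl

end Qeps

/-- **Lower bound for quantum state redistribution.** Any one-way entanglement-assisted
protocol transferring `C` from Alice to Bob with error `ε` must communicate at least
`(1/2)·Q^ε(Ψ_RABC)` qubits. -/
theorem state_redistribution_lower_bound
    {R A B C SA SB M TA TB : Type}
    [Fintype R] [Fintype A] [Fintype B] [Fintype C] [Fintype SA] [Fintype SB]
    [Fintype M] [Fintype TA] [Fintype TB]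
    [DecidableEq R] [DecidableEq A] [DecidableEq B] [DecidableEq C] [DecidableEq SA]
    [DecidableEq SB] [DecidableEq M] [DecidableEq TA] [DecidableEq TB]
    [Nonempty R] [Nonempty A] [Nonempty B] [Nonempty C] [Nonempty SA] [Nonempty SB]
    [Nonempty M] [Nonempty TA] [Nonempty TB]
    (ε : ℝ) (hε : 0 < ε)
    (ψ : (R × (B × C)) × A → ℂ) (hψ : ∑ i, ‖ψ i‖ ^ 2 = 1)
    (hcard1 : Fintype.card C * Fintype.card SA = Fintype.card M * Fintype.card TA)
    (hcard2 : Fintype.card SB * Fintype.card M = Fintype.card C * Fintype.card TB)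
    (θ : SA × SB → ℂ) (hθ : ∑ i, ‖θ i‖ ^ 2 = 1)
    (U : Matrix (M × TA) (C × SA) ℂ)
    (hU1 : U * Uᴴ = 1) (hU2 : Uᴴ * U = 1)
    (V : Matrix (B × (C × TB)) (B × (SB × M)) ℂ)
    (hV1 : V * Vᴴ = 1) (hV2 : Vᴴ * V = 1)
    (hout : IsDensityMatrix
        (ptrace2 (Matrix.vecMulVec (finalVec ψ θ U V) (star (finalVec ψ θ U V)))) ∧
      pdist (Matrix.vecMulVec ψ (star ψ))
        (ptrace2 (Matrix.vecMulVec (finalVec ψ θ U V) (star (finalVec ψ θ U V)))) ≤ ε) :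
    ((1 / 2 : ℝ) : EReal) * Qeps ε ψ ≤ ((Real.logb 2 (Fintype.card M) : ℝ) : EReal) := by
  classical
  obtain ⟨e⟩ : Nonempty (C × TB ≃ SB × M) :=
    Fintype.card_eq.1 (by rw [Fintype.card_prod, Fintype.card_prod, hcard2])
  obtain ⟨ω, r, hω, hr0, hFr, hover⟩ := exists_product_extension ψ (finalVec ψ θ U V)
  have hM : (0 : ℝ) < Fintype.card M := by exact_mod_cast Fintype.card_pos
  let ΨRB : Matrix (R × B) (R × B) ℂ :=
    ptrace2 (Matrix.reindex (Equiv.prodAssoc R B C).symm (Equiv.prodAssoc R B C).symm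
      (ptrace2 (Matrix.vecMulVec ψ (star ψ))))
  let Z₀ : Matrix (((R × B) × SB) × M) (A × TA) ℂ := aliceMatrix ψ θ U
  let Θ : Matrix SB SA ℂ := .of fun s a => θ (a, s)
  have hZ₀ : ptrace2 (Z₀ * Z₀ᴴ) = ΨRB ⊗ₖ (Θ * Θᴴ) := ptrace2_aliceMatrix ψ θ hU2
  let g : (R × B) × (C × TB) → ((R × B) × SB) × M := fun x => ((x.1, (e x.2).1), (e x.2).2)
  let Z : Matrix ((R × B) × (C × TB)) (A × TA) ℂ := Z₀.submatrix g id
  have hΘ : (Θ * Θᴴ).trace = 1 := by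
    rw [trace_of_swap_mul_conjTranspose, hθ, Complex.ofReal_one]
  have hκRB : ptrace2 (Z * Zᴴ) = ΨRB := by
    have h : ptrace2 (Z * Zᴴ) = ptrace2 (ptrace2 (Z₀ * Z₀ᴴ)) := by
      ext x y
      simp only [ptrace2]
      rw [← Fintype.sum_prod_type' (f := fun s m => (Z₀ * Z₀ᴴ) ((x, s), m) ((y, s), m)),
        ← e.sum_comp]
      rfl
    rw [h, hZ₀]
    ext x y
    simp only [ptrace2, kronecker_apply, ← Finset.mul_sum]
    rw [show ∑ s, (Θ * Θᴴ) s s = 1 from hΘ, mul_one]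
  have hκ : IsDensityMatrix (Z * Zᴴ) := by
    refine ⟨posSemidef_self_mul_conjTranspose Z, ?_⟩
    rw [← trace_ptrace2, hκRB, trace_ptrace2, reindex_apply, trace_submatrix_equiv,
      trace_ptrace2, trace_vecMulVec, ← Complex.ofReal_one, ← hψ]
    simp [dotProduct, Complex.mul_conj']
  let σ : Matrix (C × TB) (C × TB) ℂ :=
    ((Θ * Θᴴ) ⊗ₖ ((Fintype.card M : ℂ)⁻¹ • (1 : Matrix M M ℂ))).submatrix e e
  have hσ : IsDensityMatrix σ := by
    refine ⟨PosSemidef.submatrix ((posSemidef_self_mul_conjTranspose Θ).kronecker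
      (PosSemidef.one.smul (inv_nonneg.2 (Nat.cast_nonneg _)))) e, ?_⟩
    rw [trace_submatrix_equiv, trace_kronecker, hΘ, trace_smul, trace_one, one_mul, smul_eq_mul,
      inv_mul_cancel₀ (by exact_mod_cast hM.ne')]
  have hdmax : dmax (Z * Zᴴ) (ptrace2 (Z * Zᴴ) ⊗ₖ σ) ≤
      ((2 * Real.logb 2 (Fintype.card M) : ℝ) : EReal) := by
    refine dmax_le ?_
    have hpow : (2 : ℝ) ^ (2 * Real.logb 2 (Fintype.card M)) = (Fintype.card M : ℝ) ^ 2 := by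
      rw [mul_comm, Real.rpow_mul zero_le_two, Real.rpow_logb two_pos (by norm_num) hM,
        Real.rpow_two]
    have h := (posSemidef_card_smul_ptrace2_sub Z₀).submatrix g
    rw [hZ₀] at h
    rw [LoewnerLE, hpow, hκRB]
    convert h using 1
    ext ⟨x, y⟩ ⟨x', y'⟩
    obtain ⟨⟨s, m⟩, rfl⟩ := e.symm.surjective y
    obtain ⟨⟨s', m'⟩, rfl⟩ := e.symm.surjective y'
    simp only [Matrix.sub_apply, Matrix.smul_apply, submatrix_apply, kronecker_apply, σ, g, Z,
      smul_eq_mul, Equiv.apply_symm_apply, Complex.real_smul, mul_apply, conjTranspose_apply, id_eq]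
    congr 1
    push_cast
    have hMc : (Fintype.card M : ℂ) ≠ 0 := by exact_mod_cast hM.ne'
    field_simp
  let W : Matrix ((B × C) × TB) ((B × C) × TB) ℂ :=
    V.submatrix (Equiv.prodAssoc B C TB)
      ((Equiv.prodAssoc B C TB).trans (Equiv.prodCongr (Equiv.refl B) e))
  have hW : W ∈ unitaryGroup ((B × C) × TB) ℂ := by
    rw [mem_unitaryGroup_iff, star_eq_conjTranspose, conjTranspose_submatrix,
      submatrix_mul_equiv, hV1, submatrix_one_equiv]
  let Y : Matrix (R × ((B × C) × TB)) (A × TA) ℂ :=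
    .of fun x k => finalVec ψ θ U V (((x.1, x.2.1), k.1), (k.2, x.2.2))
  let X : Matrix (R × ((B × C) × TB)) (A × TA) ℂ :=
    .of fun x k => ψ ((x.1, x.2.1), k.1) * ω (k.2, x.2.2)
  have hYZ : ((1 : Matrix R R ℂ) ⊗ₖ W) * Z.submatrix (eRBCT R B C TB).symm id = Y := by
    ext ⟨r, x⟩ k
    rw [mul_apply, Fintype.sum_prod_type, Finset.sum_eq_single r]
    · simp only [kronecker_apply, one_apply_eq, one_mul]
      simp only [Y, of_apply, finalVec, stepV]
      rw [← ((Equiv.prodAssoc B C TB).trans (Equiv.prodCongr (Equiv.refl B) e)).sum_comp]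
      rfl
    · intro r' _ h
      simp [one_apply_ne (Ne.symm h)]
    · simp
  have hY : ((1 : Matrix R R ℂ) ⊗ₖ W) *
      (Matrix.reindex (eRBCT R B C TB) (eRBCT R B C TB) (Z * Zᴴ)) *
      ((1 : Matrix R R ℂ) ⊗ₖ W)ᴴ = Y * Yᴴ := by
    have h : Matrix.reindex (eRBCT R B C TB) (eRBCT R B C TB) (Z * Zᴴ) =
        Z.submatrix (eRBCT R B C TB).symm id * (Z.submatrix (eRBCT R B C TB).symm id)ᴴ := rfl
    rw [h, ← hYZ, conjTranspose_mul]
    simp only [Matrix.mul_assoc]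
  have hYd : IsDensityMatrix (Y * Yᴴ) := by
    refine ⟨posSemidef_self_mul_conjTranspose Y, ?_⟩
    have h : Wᴴ * W = 1 := by
      rw [← star_eq_conjTranspose]
      exact mem_unitaryGroup_iff'.1 hW
    rw [← hY, trace_mul_comm, ← Matrix.mul_assoc, conjTranspose_kronecker, ← mul_kronecker_mul, h,
      conjTranspose_one, Matrix.mul_one, one_kronecker_one, Matrix.one_mul, reindex_apply,
      trace_submatrix_equiv]
    exact hκ.2
  let Ω : Matrix TB TA ℂ := .of fun t a => ω (a, t)
  have hΩ : IsDensityMatrix (Ω * Ωᴴ) := by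
    refine ⟨posSemidef_self_mul_conjTranspose Ω, ?_⟩
    rw [trace_of_swap_mul_conjTranspose, hω, Complex.ofReal_one]
  have hX : Matrix.reindex (Equiv.prodAssoc R (B × C) TB) (Equiv.prodAssoc R (B × C) TB)
      (ptrace2 (Matrix.vecMulVec ψ (star ψ)) ⊗ₖ (Ω * Ωᴴ)) = X * Xᴴ := by
    ext ⟨r, bc, t⟩ ⟨r', bc', t'⟩
    simp only [reindex_apply, submatrix_apply, Equiv.prodAssoc_symm_apply, kronecker_apply,
      ptrace2, vecMulVec_apply, Pi.star_apply, mul_apply, conjTranspose_apply, of_apply, Ω, X,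
      Fintype.sum_prod_type, star_mul']
    rw [Finset.sum_mul_sum]
    refine Finset.sum_congr rfl fun a _ => Finset.sum_congr rfl fun s _ => ?_
    ring
  have hXYtr : (Yᴴ * X).trace = r := by
    rw [← hover]
    simp only [trace, diag_apply, mul_apply, conjTranspose_apply]
    exact sum_regroup fun z => star (finalVec ψ θ U V z) * (ψ z.1 * ω z.2)
  have hXY : pdist (X * Xᴴ) (Y * Yᴴ) ≤ ε := by
    refine le_trans (Real.sqrt_le_sqrt (sub_le_sub_left ?_ 1)) hout.2
    rw [hFr]
    have h := re_trace_le_fidelity X Y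
    rw [hXYtr, Complex.ofReal_re] at h
    exact pow_le_pow_left₀ hr0 h 2
  have hQ : Qeps ε ψ ≤ ((2 * Real.logb 2 (Fintype.card M) : ℝ) : EReal) :=
    (Qeps_le ε ψ hW hΩ hσ hκ hκRB hY hYd hX hXY).trans hdmax
  calc ((1 / 2 : ℝ) : EReal) * Qeps ε ψ
      ≤ ((1 / 2 : ℝ) : EReal) * ((2 * Real.logb 2 (Fintype.card M) : ℝ) : EReal) :=
        mul_le_mul_of_nonneg_left hQ (by exact_mod_cast one_half_pos.le)
    _ = ((Real.logb 2 (Fintype.card M) : ℝ) : EReal) := by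
        rw [← EReal.coe_mul]
        congr 1
        ring

end
end

section
/- Let Ψ_RABC be a pure state on R×A×B×C. Then the infimum, over quantum channels E from B to B×C, of D(Ψ_RBC ‖ (id_R⊗E)(Ψ_RB)) (valued in [0,∞]) is at most I(R:C|B)_{Ψ_RBC} plus the infimum, over all finite nonempty index types T, density matrices σ'_T on T, and unitary matrices U on B×C×T such that the density matrix γ := (I_R⊗U†)·(Ψ_RBC ⊗ σ'_T)·(I_R⊗U) on R×B×C×T satisfies γ_RB = Ψ_RB, of I(B : CT)_γ (mutual information across the bipartition B versus C×T). -/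
open scoped Kronecker BigOperators
open Matrix
open scoped ComplexOrder Classical

noncomputable section

section Channel

variable {R B C : Type} [Fintype R] [Fintype B] [Fintype C]
  [DecidableEq R] [DecidableEq B] [DecidableEq C]

/-- Application of the quantum channel with Kraus operators `K i : B → B×C` to the
`B` factor of a matrix on `R × B`, i.e. `(id_R ⊗ E)(X)`. -/
def applyChannelR {ι : Type} [Fintype ι]
    (K : ι → Matrix (B × C) B ℂ) (X : Matrix (R × B) (R × B) ℂ) :
    Matrix (R × (B × C)) (R × (B × C)) ℂ :=
  ∑ i, ((1 : Matrix R R ℂ) ⊗ₖ K i) * X * ((1 : Matrix R R ℂ) ⊗ₖ K i)ᴴ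

/-- The `R × B` marginal of a state on `R × (B × C)`. -/
def margRB (ρ : Matrix (R × (B × C)) (R × (B × C)) ℂ) : Matrix (R × B) (R × B) ℂ :=
  ptrace2 (Matrix.reindex (Equiv.prodAssoc R B C).symm (Equiv.prodAssoc R B C).symm ρ)

/-- Fidelity of recovery `F(R:C|B)_ρ`: the supremum over quantum channels
`E : B → B×C` of `F(ρ_RBC, (id_R ⊗ E)(ρ_RB))`. -/
def fidRecovery (ρ : Matrix (R × (B × C)) (R × (B × C)) ℂ) : ℝ :=
  sSup {x : ℝ | ∃ (ι : FinIdx) (K : ι.carrier → Matrix (B × C) B ℂ),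
    (∑ i, (K i)ᴴ * K i) = 1 ∧ x = fidelity ρ (applyChannelR K (margRB ρ))}

end Channel

/-- Von Neumann entropy, base 2. -/
def vnEntropy {d : Type*} [Fintype d] [DecidableEq d] (ρ : Matrix d d ℂ) : ℝ :=
  -((ρ * matLog2 ρ).trace).re

section Gamma

variable {R B C : Type} [Fintype R] [Fintype B] [Fintype C]
  [DecidableEq R] [DecidableEq B] [DecidableEq C]

/-- The state `γ = (I_R ⊗ U†)·(Ψ_RBC ⊗ σ'_T)·(I_R ⊗ U)` on `R × ((B×C) × T)`. -/
def gammaState (T : FinIdx) (ΨRBC : Matrix (R × (B × C)) (R × (B × C)) ℂ)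
    (σ' : Matrix T.carrier T.carrier ℂ)
    (U : Matrix ((B × C) × T.carrier) ((B × C) × T.carrier) ℂ) :
    Matrix (R × ((B × C) × T.carrier)) (R × ((B × C) × T.carrier)) ℂ :=
  ((1 : Matrix R R ℂ) ⊗ₖ Uᴴ) *
    (Matrix.reindex (Equiv.prodAssoc R (B × C) T.carrier)
      (Equiv.prodAssoc R (B × C) T.carrier) (ΨRBC ⊗ₖ σ')) *
    ((1 : Matrix R R ℂ) ⊗ₖ U)

end Gamma


section Spectral

variable {d n : Type*} [Fintype d] [DecidableEq d] [Fintype n] [DecidableEq n]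

/-- Spectral theorem, in the form of a conjugated real diagonal matrix. -/
lemma Matrix.IsHermitian.exists_eq_conj_diagonal {A : Matrix d d ℂ} (hA : A.IsHermitian) :
    ∃ (V : Matrix d d ℂ) (a : d → ℝ), Vᴴ * V = 1 ∧ V * Vᴴ = 1 ∧
      A = V * diagonal (fun i => (a i : ℂ)) * Vᴴ := by
  refine ⟨hA.eigenvectorUnitary, hA.eigenvalues, ?_, ?_, ?_⟩
  · exact Unitary.coe_star_mul_self hA.eigenvectorUnitary
  · exact Unitary.coe_mul_star_self hA.eigenvectorUnitary
  · exact hA.spectral_theorem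

lemma Matrix.PosSemidef.exists_eq_conj_diagonal {A : Matrix d d ℂ} (hA : A.PosSemidef) :
    ∃ (V : Matrix d d ℂ) (a : d → ℝ), Vᴴ * V = 1 ∧ V * Vᴴ = 1 ∧ (∀ i, 0 ≤ a i) ∧
      A = V * diagonal (fun i => (a i : ℂ)) * Vᴴ := by
  refine ⟨hA.1.eigenvectorUnitary, hA.1.eigenvalues, ?_, ?_, hA.eigenvalues_nonneg, ?_⟩
  · exact Unitary.coe_star_mul_self hA.1.eigenvectorUnitary
  · exact Unitary.coe_mul_star_self hA.1.eigenvectorUnitary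
  · exact hA.1.spectral_theorem

omit [Fintype d] [DecidableEq d] in
lemma isHermitian_conj_diagonal (V : Matrix d n ℂ) (a : n → ℝ) :
    (V * diagonal (fun i => (a i : ℂ)) * Vᴴ).IsHermitian := by
  have h : (diagonal (fun i => (a i : ℂ)) : Matrix n n ℂ).IsHermitian := by
    rw [Matrix.isHermitian_diagonal_iff]
    intro i
    exact Complex.conj_ofReal _
  exact isHermitian_mul_mul_conjTranspose V h

/-- The functional calculus may be computed in any orthonormal eigenbasis. -/
lemma hermCFC_conj_diagonal (f : ℝ → ℝ) {V : Matrix d n ℂ} (hV : Vᴴ * V = 1) (hV' : V * Vᴴ = 1)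
    (a : n → ℝ) :
    hermCFC f (V * diagonal (fun i => (a i : ℂ)) * Vᴴ) =
      V * diagonal (fun i => (f (a i) : ℂ)) * Vᴴ := by
  have hA := isHermitian_conj_diagonal V a
  rw [hermCFC, dif_pos hA]
  set A := V * diagonal (fun i => (a i : ℂ)) * Vᴴ with hAdef
  set U : Matrix d d ℂ := (hA.eigenvectorUnitary : Matrix d d ℂ) with hU
  set l := hA.eigenvalues with hl
  have hUU : Uᴴ * U = 1 := Unitary.coe_star_mul_self hA.eigenvectorUnitary
  have hUU' : U * Uᴴ = 1 := Unitary.coe_mul_star_self hA.eigenvectorUnitary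
  have hsp : A = U * diagonal (fun i => (l i : ℂ)) * Uᴴ := hA.spectral_theorem
  have key : diagonal (fun i => (l i : ℂ)) * (Uᴴ * V) =
      (Uᴴ * V) * diagonal (fun i => (a i : ℂ)) := by
    calc diagonal (fun i => (l i : ℂ)) * (Uᴴ * V)
        = (Uᴴ * U) * diagonal (fun i => (l i : ℂ)) * (Uᴴ * V) := by rw [hUU, Matrix.one_mul]
      _ = Uᴴ * (U * diagonal (fun i => (l i : ℂ)) * Uᴴ) * V := by
          simp only [Matrix.mul_assoc]
      _ = Uᴴ * A * V := by rw [← hsp]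
      _ = Uᴴ * V * diagonal (fun i => (a i : ℂ)) * (Vᴴ * V) := by
          rw [hAdef]; simp only [Matrix.mul_assoc]
      _ = _ := by rw [hV, Matrix.mul_one]
  have key2 : diagonal (fun i => (f (l i) : ℂ)) * (Uᴴ * V) =
      (Uᴴ * V) * diagonal (fun i => (f (a i) : ℂ)) := by
    ext i j
    have h := congrFun (congrFun key i) j
    rw [diagonal_mul, mul_diagonal] at h ⊢
    by_cases h0 : (Uᴴ * V) i j = 0
    · simp [h0]
    · rw [mul_comm] at h
      have h1 : (l i : ℂ) = a j := mul_left_cancel₀ h0 h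
      have h2 : l i = a j := by exact_mod_cast h1
      rw [h2, mul_comm]
  calc U * diagonal (fun i => (f (l i) : ℂ)) * Uᴴ
      = U * diagonal (fun i => (f (l i) : ℂ)) * Uᴴ * (V * Vᴴ) := by rw [hV', Matrix.mul_one]
    _ = U * (diagonal (fun i => (f (l i) : ℂ)) * (Uᴴ * V)) * Vᴴ := by
        simp only [Matrix.mul_assoc]
    _ = (U * Uᴴ) * V * diagonal (fun i => (f (a i) : ℂ)) * Vᴴ := by
        rw [key2]; simp only [Matrix.mul_assoc]
    _ = _ := by rw [hUU', Matrix.one_mul]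

lemma hermCFC_conj (f : ℝ → ℝ) {V : Matrix n d ℂ} (hV : Vᴴ * V = 1) (hV' : V * Vᴴ = 1)
    {A : Matrix d d ℂ} (hA : A.IsHermitian) :
    hermCFC f (V * A * Vᴴ) = V * hermCFC f A * Vᴴ := by
  obtain ⟨U, a, hU, hU', rfl⟩ := hA.exists_eq_conj_diagonal
  have h1 : (V * U)ᴴ * (V * U) = 1 := by
    rw [conjTranspose_mul, Matrix.mul_assoc, ← Matrix.mul_assoc Vᴴ, hV, Matrix.one_mul, hU]
  have h2 : (V * U) * (V * U)ᴴ = 1 := by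
    rw [conjTranspose_mul, Matrix.mul_assoc, ← Matrix.mul_assoc U, hU', Matrix.one_mul, hV']
  have h := hermCFC_conj_diagonal f h1 h2 a
  rw [hermCFC_conj_diagonal f hU hU']
  simpa only [conjTranspose_mul, Matrix.mul_assoc] using h

omit [DecidableEq d] in
lemma trace_mul_conj_diagonal (M : Matrix d d ℂ) (V : Matrix d n ℂ) (b : n → ℝ) :
    (M * (V * diagonal (fun i => (b i : ℂ)) * Vᴴ)).trace.re =
      ∑ i, ((Vᴴ * M * V) i i).re * b i := by
  rw [← Matrix.mul_assoc, trace_mul_comm, ← Matrix.mul_assoc, ← Matrix.mul_assoc, trace]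
  simp [Matrix.mul_diagonal]

lemma trace_mul_matLog2_conj_diagonal (M : Matrix d d ℂ) {V : Matrix d n ℂ} (hV : Vᴴ * V = 1)
    (hV' : V * Vᴴ = 1) (a : n → ℝ) :
    (M * matLog2 (V * diagonal (fun i => (a i : ℂ)) * Vᴴ)).trace.re =
      ∑ i, ((Vᴴ * M * V) i i).re * Real.logb 2 (a i) := by
  rw [matLog2, hermCFC_conj_diagonal _ hV hV', trace_mul_conj_diagonal]

omit [DecidableEq d] in
lemma conj_conj_diagonal {V : Matrix d n ℂ} (hV : Vᴴ * V = 1) (a : n → ℝ) :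
    Vᴴ * (V * diagonal (fun i => (a i : ℂ)) * Vᴴ) * V = diagonal (fun i => (a i : ℂ)) := by
  calc _ = (Vᴴ * V) * diagonal (fun i => (a i : ℂ)) * (Vᴴ * V) := by
        simp only [Matrix.mul_assoc]
    _ = _ := by rw [hV, Matrix.one_mul, Matrix.mul_one]

lemma vnEntropy_conj_diagonal {V : Matrix d n ℂ} (hV : Vᴴ * V = 1) (hV' : V * Vᴴ = 1)
    (a : n → ℝ) : vnEntropy (V * diagonal (fun i => (a i : ℂ)) * Vᴴ) =
      -∑ i, a i * Real.logb 2 (a i) := by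
  rw [vnEntropy, trace_mul_matLog2_conj_diagonal _ hV hV', conj_conj_diagonal hV]
  simp

lemma vnEntropy_conj {V : Matrix n d ℂ} (hV : Vᴴ * V = 1) (hV' : V * Vᴴ = 1)
    {A : Matrix d d ℂ} (hA : A.IsHermitian) : vnEntropy (V * A * Vᴴ) = vnEntropy A := by
  have h : V * A * Vᴴ * (V * matLog2 A * Vᴴ) = V * (A * matLog2 A) * Vᴴ := by
    calc _ = V * A * (Vᴴ * V) * (matLog2 A * Vᴴ) := by simp only [Matrix.mul_assoc]
      _ = _ := by rw [hV, Matrix.mul_one]; simp only [Matrix.mul_assoc]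
  rw [vnEntropy, vnEntropy, matLog2, hermCFC_conj _ hV hV' hA, ← matLog2, h, trace_mul_comm,
    ← Matrix.mul_assoc, hV, Matrix.one_mul]

lemma relent_conj {V : Matrix n d ℂ} (hV : Vᴴ * V = 1) (hV' : V * Vᴴ = 1)
    {A B : Matrix d d ℂ} (hA : A.IsHermitian) (hB : B.IsHermitian) :
    relent (V * A * Vᴴ) (V * B * Vᴴ) = relent A B := by
  have h (X : Matrix d d ℂ) : (V * A * Vᴴ * (V * X * Vᴴ)).trace = (A * X).trace := by
    calc _ = (V * (A * (Vᴴ * V) * X) * Vᴴ).trace := by simp only [Matrix.mul_assoc]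
      _ = _ := by
        rw [hV, Matrix.mul_one, trace_mul_comm, ← Matrix.mul_assoc, hV, Matrix.one_mul]
  have hR : relentR (V * A * Vᴴ) (V * B * Vᴴ) = relentR A B := by
    rw [relentR, relentR, matLog2, matLog2, hermCFC_conj _ hV hV' hA, hermCFC_conj _ hV hV' hB,
      h, h]
    rfl
  have hz (X : Matrix d d ℂ) (v : n → ℂ) :
      (V * X * Vᴴ) *ᵥ v = 0 ↔ X *ᵥ (Vᴴ *ᵥ v) = 0 := by
    rw [← mulVec_mulVec, ← mulVec_mulVec]
    refine ⟨fun hv => ?_, fun hv => by rw [hv, mulVec_zero]⟩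
    have h1 := congrArg (Vᴴ *ᵥ ·) hv
    simp only [mulVec_zero] at h1
    rwa [mulVec_mulVec, hV, one_mulVec] at h1
  have hS : SupportLE (V * A * Vᴴ) (V * B * Vᴴ) ↔ SupportLE A B := by
    refine ⟨fun H v hv => ?_, fun H v hv => ?_⟩
    · have hw : Vᴴ *ᵥ (V *ᵥ v) = v := by rw [mulVec_mulVec, hV, one_mulVec]
      have := H (V *ᵥ v)
      rw [hz, hz, hw] at this
      exact this hv
    · rw [hz] at hv ⊢
      exact H _ hv
  rw [relent, relent, hR]
  simp only [hS]

lemma exists_reindex_eq_conj (e : d ≃ n) : ∃ P : Matrix n d ℂ, Pᴴ * P = 1 ∧ P * Pᴴ = 1 ∧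
    ∀ A : Matrix d d ℂ, reindex e e A = P * A * Pᴴ := by
  refine ⟨(1 : Matrix d d ℂ).submatrix e.symm id, ?_, ?_, fun A => ?_⟩
  · rw [conjTranspose_submatrix, conjTranspose_one, submatrix_mul_equiv]; simp
  · have := submatrix_mul_equiv (1 : Matrix d d ℂ) (1 : Matrix d d ℂ) e.symm (Equiv.refl d) e.symm
    rw [conjTranspose_submatrix, conjTranspose_one]
    simpa using this
  · ext i j
    simp [Matrix.mul_apply, Matrix.one_apply]

lemma vnEntropy_reindex (e : d ≃ n) {A : Matrix d d ℂ} (hA : A.IsHermitian) :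
    vnEntropy (reindex e e A) = vnEntropy A := by
  obtain ⟨P, h1, h2, h3⟩ := exists_reindex_eq_conj e
  rw [h3, vnEntropy_conj h1 h2 hA]

lemma relent_reindex (e : d ≃ n) {A B : Matrix d d ℂ} (hA : A.IsHermitian)
    (hB : B.IsHermitian) : relent (reindex e e A) (reindex e e B) = relent A B := by
  obtain ⟨P, h1, h2, h3⟩ := exists_reindex_eq_conj e
  rw [h3, h3, relent_conj h1 h2 hA hB]

/-- Support containment, read off the diagonal of `ρ` in an eigenbasis of `σ`. -/
lemma supportLE_conj_diagonal_iff {ρ : Matrix d d ℂ} (hρ : ρ.PosSemidef) {V : Matrix d n ℂ}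
    (hV : Vᴴ * V = 1) (hV' : V * Vᴴ = 1) (q : n → ℝ) :
    SupportLE ρ (V * diagonal (fun i => (q i : ℂ)) * Vᴴ) ↔
      ∀ j, q j = 0 → (Vᴴ * ρ * V) j j = 0 := by
  have hρ' : (Vᴴ * ρ * V).PosSemidef := hρ.conjTranspose_mul_mul_same V
  constructor
  · intro H j hj
    have h := H (V *ᵥ Pi.single j 1) (by
      rw [mulVec_mulVec, Matrix.mul_assoc, hV, Matrix.mul_one, ← mulVec_mulVec,
        diagonal_mulVec_single]
      simp [hj])
    have h2 : (Vᴴ * ρ * V) *ᵥ Pi.single j 1 = 0 := by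
      rw [← mulVec_mulVec, ← mulVec_mulVec, h, mulVec_zero]
    simpa using congrFun h2 j
  · intro H v hv
    have h1 : diagonal (fun i => (q i : ℂ)) *ᵥ (Vᴴ *ᵥ v) = 0 := by
      have := congrArg (Vᴴ *ᵥ ·) hv
      simpa [mulVec_mulVec, ← Matrix.mul_assoc, hV] using this
    have h2 : (Vᴴ * ρ * V) *ᵥ (Vᴴ *ᵥ v) = 0 := by
      have hsum : Vᴴ *ᵥ v = ∑ j, Pi.single j ((Vᴴ *ᵥ v) j) := by
        rw [Finset.univ_sum_single]
      rw [hsum, mulVec_sum]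
      refine Finset.sum_eq_zero fun j _ => ?_
      have h3 := congrFun h1 j
      rw [mulVec_diagonal] at h3
      rcases mul_eq_zero.mp h3 with h4 | h4
      · have h5 := H j (by exact_mod_cast h4)
        have h6 : (Vᴴ * ρ * V) *ᵥ Pi.single j 1 = 0 := by
          rw [← hρ'.dotProduct_mulVec_zero_iff]
          simp [Pi.star_single, h5]
        have h7 : (Pi.single j ((Vᴴ *ᵥ v) j) : n → ℂ) = ((Vᴴ *ᵥ v) j) • Pi.single j 1 := by
          rw [← Pi.single_smul, smul_eq_mul, mul_one]
        rw [h7, mulVec_smul, h6, smul_zero]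
      · rw [h4, Pi.single_zero, mulVec_zero]
    have h8 := congrArg (V *ᵥ ·) h2
    simpa [mulVec_mulVec, ← Matrix.mul_assoc, hV', Matrix.mul_assoc ρ V] using h8

end Spectral

section ScalarComparison

open Filter Topology

lemma hasDerivAt_sum_mul_log_add {α : Type*} [Fintype α] {a x : α → ℝ}
    (hx : ∀ k, a k ≠ 0 → 0 < x k) (t : ℝ)
    (ht : 0 ≤ t) : HasDerivAt (fun t => ∑ k, a k * Real.log (x k + t))
      (∑ k, a k / (x k + t)) t := by
  refine HasDerivAt.fun_sum fun k _ => ?_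
  by_cases hk : a k = 0
  · simpa [hk] using hasDerivAt_const t (0 : ℝ)
  · have hpos : x k + t ≠ 0 := by have := hx k hk; positivity
    have h1 := (((hasDerivAt_id t).const_add (x k)).log hpos).const_mul (a k)
    simpa [div_eq_mul_inv] using h1

lemma tendsto_sum_mul_log_add_sub_log {α : Type*} [Fintype α] (a x : α → ℝ) :
    Tendsto (fun t => ∑ k, a k * (Real.log (x k + t) - Real.log t)) atTop (𝓝 0) := by
  rw [show (0 : ℝ) = ∑ k, a k * 0 by simp]
  refine tendsto_finsetSum _ fun k _ => Tendsto.const_mul _ ?_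
  have h1 : Tendsto (fun t : ℝ => 1 + x k / t) atTop (𝓝 1) := by
    simpa using (tendsto_const_nhds (x := (1 : ℝ))).add
      (tendsto_const_nhds.div_atTop (tendsto_id (α := ℝ)))
  have h2 := h1.log one_ne_zero
  rw [Real.log_one] at h2
  refine h2.congr' ?_
  filter_upwards [eventually_gt_atTop (0 : ℝ), eventually_gt_atTop (-x k)] with t ht hxt
  rw [← Real.log_div (by linarith) ht.ne']
  congr 1
  field_simp
  ring

/-- Comparison of logarithmic sums from a comparison of the derivatives in a shift `t`. -/
lemma sum_mul_log_le_of_sum_div_le {ι κ : Type*} [Fintype ι] [Fintype κ] {c s : ι → ℝ}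
    {d r : κ → ℝ} (hs : ∀ k, c k ≠ 0 → 0 < s k) (hr : ∀ k, d k ≠ 0 → 0 < r k)
    (hcd : ∑ k, c k = ∑ k, d k)
    (h : ∀ t : ℝ, 0 < t → ∑ k, c k / (s k + t) ≤ ∑ k, d k / (r k + t)) :
    ∑ k, d k * Real.log (r k) ≤ ∑ k, c k * Real.log (s k) := by
  set g : ℝ → ℝ := fun t =>
    ∑ k, d k * Real.log (r k + t) - ∑ k, c k * Real.log (s k + t) with hg
  have hgd (t : ℝ) (ht : 0 ≤ t) :
      HasDerivAt g (∑ k, d k / (r k + t) - ∑ k, c k / (s k + t)) t :=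
    (hasDerivAt_sum_mul_log_add hr t ht).sub (hasDerivAt_sum_mul_log_add hs t ht)
  have hmono : MonotoneOn g (Set.Ici 0) := by
    refine monotoneOn_of_deriv_nonneg (convex_Ici 0)
      (fun t ht => (hgd t ht).continuousAt.continuousWithinAt)
      (fun t ht => ?_) (fun t ht => ?_)
    · rw [interior_Ici] at ht
      exact (hgd t (le_of_lt ht)).differentiableAt.differentiableWithinAt
    · rw [interior_Ici] at ht
      rw [(hgd t (le_of_lt ht)).deriv]
      exact sub_nonneg.mpr (h t ht)
  have hglim : Tendsto g atTop (𝓝 0) := by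
    have h1 := (tendsto_sum_mul_log_add_sub_log d r).sub (tendsto_sum_mul_log_add_sub_log c s)
    rw [sub_zero] at h1
    refine h1.congr fun t => ?_
    simp only [hg, mul_sub, Finset.sum_sub_distrib, ← Finset.sum_mul, hcd]
    ring
  have h0 : g 0 ≤ 0 := by
    refine ge_of_tendsto hglim ?_
    filter_upwards [eventually_ge_atTop (0 : ℝ)] with t ht
    exact hmono (Set.mem_Ici.mpr le_rfl) ht ht
  simpa [hg] using h0

end ScalarComparison

section PartialTrace

variable {d e : Type*} [Fintype d] [DecidableEq d] [Fintype e] [DecidableEq e]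

/-- The quadratic functional in `X` whose maximum is the resolvent of the relative modular
operator of `ρ` and `σ` at `-t`. -/
def resolventForm (ρ σ : Matrix d d ℂ) (t : ℝ) (X : Matrix d d ℂ) : ℝ :=
  2 * (Xᴴ * ρ).trace.re - (Xᴴ * σ * X).trace.re - t * (X * ρ * Xᴴ).trace.re

lemma resolventForm_conj_diagonal {V U : Matrix d d ℂ} (hV : Vᴴ * V = 1) (hU : Uᴴ * U = 1)
    (p q : d → ℝ) (t : ℝ) (Y : Matrix d d ℂ) :
    resolventForm (V * diagonal (fun i => (p i : ℂ)) * Vᴴ)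
        (U * diagonal (fun i => (q i : ℂ)) * Uᴴ) t (U * Y * Vᴴ) =
      ∑ j, ∑ i, (2 * ((star (Y j i) * (Uᴴ * V) j i).re * p i)
        - Complex.normSq (Y j i) * (q j + t * p i)) := by
  have h1 : ((U * Y * Vᴴ)ᴴ * (V * diagonal (fun i => (p i : ℂ)) * Vᴴ)).trace =
      (Yᴴ * (Uᴴ * V) * diagonal (fun i => (p i : ℂ))).trace := by
    rw [show (U * Y * Vᴴ)ᴴ * (V * diagonal (fun i => (p i : ℂ)) * Vᴴ) =
      V * (Yᴴ * (Uᴴ * V) * diagonal (fun i => (p i : ℂ)) * Vᴴ) by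
        simp only [conjTranspose_mul, conjTranspose_conjTranspose, Matrix.mul_assoc],
      trace_mul_comm, Matrix.mul_assoc, hV, Matrix.mul_one]
  have h2 : ((U * Y * Vᴴ)ᴴ * (U * diagonal (fun i => (q i : ℂ)) * Uᴴ) * (U * Y * Vᴴ)).trace =
      (Yᴴ * diagonal (fun i => (q i : ℂ)) * Y).trace := by
    rw [show (U * Y * Vᴴ)ᴴ * (U * diagonal (fun i => (q i : ℂ)) * Uᴴ) * (U * Y * Vᴴ) =
      V * (Yᴴ * (Uᴴ * U) * diagonal (fun i => (q i : ℂ)) * (Uᴴ * U) * Y * Vᴴ) by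
        simp only [conjTranspose_mul, conjTranspose_conjTranspose, Matrix.mul_assoc],
      trace_mul_comm, Matrix.mul_assoc, hV, hU, Matrix.mul_one, Matrix.mul_one, Matrix.mul_one]
  have h3 : ((U * Y * Vᴴ) * (V * diagonal (fun i => (p i : ℂ)) * Vᴴ) * (U * Y * Vᴴ)ᴴ).trace =
      (Y * diagonal (fun i => (p i : ℂ)) * Yᴴ).trace := by
    rw [show (U * Y * Vᴴ) * (V * diagonal (fun i => (p i : ℂ)) * Vᴴ) * (U * Y * Vᴴ)ᴴ =
      U * (Y * (Vᴴ * V) * diagonal (fun i => (p i : ℂ)) * (Vᴴ * V) * Yᴴ * Uᴴ) by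
        simp only [conjTranspose_mul, conjTranspose_conjTranspose, Matrix.mul_assoc],
      trace_mul_comm, Matrix.mul_assoc, hV, hU, Matrix.mul_one, Matrix.mul_one, Matrix.mul_one]
  have e1 : (Yᴴ * (Uᴴ * V) * diagonal (fun i => (p i : ℂ))).trace.re =
      ∑ j, ∑ i, (star (Y j i) * (Uᴴ * V) j i).re * p i := by
    rw [Finset.sum_comm]
    simp only [trace, diag_apply, mul_diagonal, Complex.re_sum, Complex.re_mul_ofReal]
    refine Finset.sum_congr rfl fun i _ => ?_
    rw [Matrix.mul_apply, Complex.re_sum, Finset.sum_mul]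
    rfl
  have e2 : (Yᴴ * diagonal (fun i => (q i : ℂ)) * Y).trace.re =
      ∑ j, ∑ i, Complex.normSq (Y j i) * q j := by
    rw [Finset.sum_comm]
    simp only [trace, diag_apply, Complex.re_sum]
    refine Finset.sum_congr rfl fun i _ => ?_
    rw [Matrix.mul_apply, Complex.re_sum]
    refine Finset.sum_congr rfl fun j _ => ?_
    rw [mul_diagonal, conjTranspose_apply, Complex.normSq_apply]
    simp
    ring
  have e3 : (Y * diagonal (fun i => (p i : ℂ)) * Yᴴ).trace.re =
      ∑ j, ∑ i, Complex.normSq (Y j i) * p i := by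
    simp only [trace, diag_apply, Complex.re_sum]
    refine Finset.sum_congr rfl fun i _ => ?_
    rw [Matrix.mul_apply, Complex.re_sum]
    refine Finset.sum_congr rfl fun j _ => ?_
    rw [mul_diagonal, conjTranspose_apply, Complex.normSq_apply]
    simp
    ring
  rw [resolventForm, h1, h2, h3, e1, e2, e3]
  simp only [Finset.mul_sum, ← Finset.sum_sub_distrib]
  refine Finset.sum_congr rfl fun j _ => Finset.sum_congr rfl fun i _ => ?_
  ring

lemma two_mul_re_sub_normSq_mul_le {p D : ℝ} (hD : 0 ≤ D) (hpD : D = 0 → p = 0) (y z : ℂ) :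
    2 * ((star y * z).re * p) - Complex.normSq y * D ≤ p ^ 2 * Complex.normSq z / D := by
  rcases hD.eq_or_lt with h0 | h0
  · simp [← h0, hpD h0.symm]
  · rw [le_div_iff₀ h0]
    have : (star y * z).re = y.re * z.re + y.im * z.im := by simp
    rw [this, Complex.normSq_apply, Complex.normSq_apply]
    nlinarith [sq_nonneg (p * z.re - D * y.re), sq_nonneg (p * z.im - D * y.im)]

lemma two_mul_re_sub_normSq_mul_eq (p D : ℝ) (z : ℂ) :
    2 * ((star (((p / D : ℝ) : ℂ) * z) * z).re * p)
      - Complex.normSq (((p / D : ℝ) : ℂ) * z) * D = p ^ 2 * Complex.normSq z / D := by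
  have : (star (((p / D : ℝ) : ℂ) * z) * z).re = p / D * Complex.normSq z := by
    rw [Complex.normSq_apply]
    simp
    ring
  rw [this, map_mul, Complex.normSq_ofReal]
  by_cases hD : D = 0
  · simp [hD]
  · field_simp
    ring

omit [Fintype d] [DecidableEq e] in
lemma sum_normSq_col_eq_one {Z : Matrix e d ℂ} (hZ : Zᴴ * Z = 1) (i : d) :
    ∑ j, Complex.normSq (Z j i) = 1 := by
  have h := congrArg Complex.re (congrFun (congrFun hZ i) i)
  rw [Matrix.mul_apply, Complex.re_sum, one_apply_eq, Complex.one_re] at h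
  rw [← h]
  refine Finset.sum_congr rfl fun j _ => ?_
  simp [Complex.normSq_apply]

omit [Fintype e] [DecidableEq e] in
lemma re_conj_diagonal_apply (Z : Matrix e d ℂ) (p : d → ℝ) (j : e) :
    ((Z * diagonal (fun i => (p i : ℂ)) * Zᴴ) j j).re = ∑ i, Complex.normSq (Z j i) * p i := by
  rw [Matrix.mul_apply, Complex.re_sum]
  refine Finset.sum_congr rfl fun i _ => ?_
  rw [mul_diagonal, conjTranspose_apply, Complex.normSq_apply]
  simp
  ring

/-- The relative entropy as a sum of logarithms with nonnegative weights, together with a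
variational formula for the corresponding resolvents. -/
lemma exists_relative_spectrum {ρ σ : Matrix d d ℂ} (hρ : ρ.PosSemidef) (hσ : σ.PosSemidef)
    (h : SupportLE ρ σ) :
    ∃ c s : d × d → ℝ, (∀ k, c k ≠ 0 → 0 < s k) ∧ ∑ k, c k = ρ.trace.re ∧
      relentR ρ σ * Real.log 2 = -∑ k, c k * Real.log (s k) ∧
      ∀ t : ℝ, 0 < t →
        IsGreatest (Set.range (resolventForm ρ σ t)) (∑ k, c k / (s k + t)) := by
  obtain ⟨V, p, hV, hV', hp, rfl⟩ := hρ.exists_eq_conj_diagonal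
  obtain ⟨U, q, hU, hU', hq, rfl⟩ := hσ.exists_eq_conj_diagonal
  rw [supportLE_conj_diagonal_iff hρ hU hU'] at h
  set Z : Matrix d d ℂ := Uᴴ * V with hZdef
  have hZ : Zᴴ * Z = 1 := by
    rw [hZdef, conjTranspose_mul, conjTranspose_conjTranspose, Matrix.mul_assoc,
      ← Matrix.mul_assoc U, hU', Matrix.one_mul, hV]
  have hconj : Uᴴ * (V * diagonal (fun i => (p i : ℂ)) * Vᴴ) * U =
      Z * diagonal (fun i => (p i : ℂ)) * Zᴴ := by
    rw [hZdef, conjTranspose_mul, conjTranspose_conjTranspose]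
    simp only [Matrix.mul_assoc]
  have hqc (j i : d) (hj : q j = 0) : p i * Complex.normSq (Z j i) = 0 := by
    have h1 := congrArg Complex.re (h j hj)
    rw [hconj, re_conj_diagonal_apply, Complex.zero_re, Finset.sum_eq_zero_iff_of_nonneg
      (fun i _ => mul_nonneg (Complex.normSq_nonneg _) (hp i))] at h1
    rw [mul_comm]
    exact h1 i (Finset.mem_univ _)
  have hpos (j i : d) (hc : p i * Complex.normSq (Z j i) ≠ 0) : 0 < p i ∧ 0 < q j :=
    ⟨(hp i).lt_of_ne' (left_ne_zero_of_mul hc), (hq j).lt_of_ne' fun h0 => hc (hqc j i h0)⟩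
  refine ⟨fun k => p k.2 * Complex.normSq (Z k.1 k.2), fun k => q k.1 / p k.2,
    fun k hk => ?_, ?_, ?_, fun t ht => ?_⟩
  · exact div_pos (hpos _ _ hk).2 (hpos _ _ hk).1
  · rw [Fintype.sum_prod_type, Finset.sum_comm]
    simp only [← Finset.mul_sum, sum_normSq_col_eq_one hZ, mul_one]
    rw [trace_mul_comm, ← Matrix.mul_assoc, hV, Matrix.one_mul, trace]
    simp
  · have hlog (x : ℝ) : Real.logb 2 x * Real.log 2 = Real.log x :=
      div_mul_cancel₀ _ (Real.log_pos one_lt_two).ne'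
    rw [relentR, Complex.sub_re, trace_mul_matLog2_conj_diagonal _ hV hV',
      trace_mul_matLog2_conj_diagonal _ hU hU', conj_conj_diagonal hV, hconj]
    simp only [re_conj_diagonal_apply]
    simp only [sub_mul, Finset.sum_mul, mul_assoc, hlog]
    rw [Fintype.sum_prod_type, ← Finset.sum_neg_distrib]
    have h1 : ∑ i, ((diagonal (fun i => (p i : ℂ)) : Matrix d d ℂ) i i).re * Real.log (p i) =
        ∑ j, ∑ i, Complex.normSq (Z j i) * (p i * Real.log (p i)) := by
      rw [Finset.sum_comm]
      simp only [← Finset.sum_mul, sum_normSq_col_eq_one hZ, one_mul, diagonal_apply_eq,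
        Complex.ofReal_re]
    rw [h1, ← Finset.sum_sub_distrib]
    refine Finset.sum_congr rfl fun j _ => ?_
    rw [← Finset.sum_neg_distrib, ← Finset.sum_sub_distrib]
    refine Finset.sum_congr rfl fun i _ => ?_
    by_cases hc : p i * Complex.normSq (Z j i) = 0
    · linear_combination (Real.log (p i) - Real.log (q j) + Real.log (q j / p i)) * hc
    · rw [Real.log_div (hpos j i hc).2.ne' (hpos j i hc).1.ne']
      ring
  · have hF : ∑ k : d × d, p k.2 * Complex.normSq (Z k.1 k.2) / (q k.1 / p k.2 + t) =
        ∑ j, ∑ i, p i ^ 2 * Complex.normSq (Z j i) / (q j + t * p i) := by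
      rw [Fintype.sum_prod_type]
      refine Finset.sum_congr rfl fun j _ => Finset.sum_congr rfl fun i _ => ?_
      rcases (hp i).eq_or_lt with h0 | h0
      · simp [← h0]
      · have h1 : q j / p i + t = (q j + t * p i) / p i := by field_simp
        rw [h1, div_div_eq_mul_div]
        ring
    rw [hF]
    refine ⟨⟨U * (Matrix.of fun j i => ((p i / (q j + t * p i) : ℝ) : ℂ) * Z j i) * Vᴴ, ?_⟩, ?_⟩
    · rw [resolventForm_conj_diagonal hV hU, ← hZdef]
      simp only [of_apply, two_mul_re_sub_normSq_mul_eq]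
    · rintro _ ⟨X, rfl⟩
      have hX : X = U * (Uᴴ * X * V) * Vᴴ := by
        rw [show U * (Uᴴ * X * V) * Vᴴ = (U * Uᴴ) * X * (V * Vᴴ) by
          simp only [Matrix.mul_assoc], hU', hV', Matrix.one_mul, Matrix.mul_one]
      rw [hX, resolventForm_conj_diagonal hV hU]
      refine Finset.sum_le_sum fun j _ => Finset.sum_le_sum fun i _ => ?_
      have hp' := hp i
      have hq' := hq j
      refine two_mul_re_sub_normSq_mul_le (by positivity) (fun h0 => ?_) _ _
      have h1 : t * p i = 0 := by
        have : 0 ≤ t * p i := by positivity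
        linarith
      exact (mul_eq_zero.mp h1).resolve_left ht.ne'

omit [DecidableEq d] in
lemma ptrace2_mulVec_apply (M : Matrix (d × e) (d × e) ℂ) (v : d → ℂ) (i : d) :
    (ptrace2 M *ᵥ v) i =
      ∑ k, (M *ᵥ fun x => v x.1 * (if x.2 = k then 1 else 0)) (i, k) := by
  simp only [mulVec, dotProduct, ptrace2, Fintype.sum_prod_type, Finset.sum_mul]
  rw [Finset.sum_comm]
  simp

omit [DecidableEq d] in
lemma SupportLE.ptrace2 {M N : Matrix (d × e) (d × e) ℂ} (hN : N.PosSemidef)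
    (h : SupportLE M N) : SupportLE (ptrace2 M) (ptrace2 N) := by
  intro v hv
  have hsum : ∑ k, star (fun x : d × e => v x.1 * (if x.2 = k then 1 else 0)) ⬝ᵥ
      (N *ᵥ fun x => v x.1 * (if x.2 = k then 1 else 0)) = 0 := by
    have h1 : star v ⬝ᵥ (_root_.ptrace2 N *ᵥ v) = 0 := by rw [hv, dotProduct_zero]
    refine Eq.trans ?_ h1
    simp only [dotProduct, ptrace2_mulVec_apply, Finset.mul_sum, Fintype.sum_prod_type]
    rw [Finset.sum_comm]
    refine Finset.sum_congr rfl fun i _ => Finset.sum_congr rfl fun k _ => ?_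
    simp [apply_ite]
  rw [Finset.sum_eq_zero_iff_of_nonneg (fun k _ => hN.dotProduct_mulVec_nonneg _)] at hsum
  ext i
  rw [ptrace2_mulVec_apply]
  refine Finset.sum_eq_zero fun k hk => ?_
  rw [h _ ((hN.dotProduct_mulVec_zero_iff _).mp (hsum k hk))]
  rfl

omit [DecidableEq d] [DecidableEq e] in
lemma trace_ptrace2_s15 (M : Matrix (d × e) (d × e) ℂ) : (ptrace2 M).trace = M.trace := by
  simp [trace, ptrace2, Fintype.sum_prod_type]

omit [DecidableEq d] in
lemma ptrace2_kronecker_one_mul (X : Matrix d d ℂ) (M : Matrix (d × e) (d × e) ℂ) :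
    ptrace2 ((X ⊗ₖ (1 : Matrix e e ℂ)) * M) = X * ptrace2 M := by
  ext i j
  simp only [ptrace2, Matrix.mul_apply, Fintype.sum_prod_type, kroneckerMap_apply, one_apply,
    Finset.mul_sum]
  rw [Finset.sum_comm]
  simp

omit [DecidableEq d] in
lemma ptrace2_mul_kronecker_one (X : Matrix d d ℂ) (M : Matrix (d × e) (d × e) ℂ) :
    ptrace2 (M * (X ⊗ₖ (1 : Matrix e e ℂ))) = ptrace2 M * X := by
  ext i j
  simp only [ptrace2, Matrix.mul_apply, Fintype.sum_prod_type, kroneckerMap_apply, one_apply,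
    Finset.sum_mul]
  rw [Finset.sum_comm]
  simp

omit [DecidableEq d] in
lemma resolventForm_ptrace2 (M N : Matrix (d × e) (d × e) ℂ) (t : ℝ) (X : Matrix d d ℂ) :
    resolventForm (ptrace2 M) (ptrace2 N) t X =
      resolventForm M N t (X ⊗ₖ (1 : Matrix e e ℂ)) := by
  have h : (X ⊗ₖ (1 : Matrix e e ℂ))ᴴ = Xᴴ ⊗ₖ (1 : Matrix e e ℂ) := by
    rw [conjTranspose_kronecker, conjTranspose_one]
  simp only [resolventForm, h, ← trace_ptrace2_s15 (d := d) (e := e), ptrace2_mul_kronecker_one,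
    ptrace2_kronecker_one_mul]

/-- Data processing: the relative entropy does not increase under a partial trace. -/
theorem relent_ptrace2_le {M N : Matrix (d × e) (d × e) ℂ} (hM : M.PosSemidef)
    (hN : N.PosSemidef) (hM' : (ptrace2 M).PosSemidef) (hN' : (ptrace2 N).PosSemidef) :
    relent (ptrace2 M) (ptrace2 N) ≤ relent M N := by
  by_cases h : SupportLE M N
  · have h' := h.ptrace2 hN
    rw [relent, relent, if_pos h, if_pos h', EReal.coe_le_coe_iff]
    obtain ⟨c, s, hs, hc, hD, hF⟩ := exists_relative_spectrum hM' hN' h'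
    obtain ⟨a, r, hr, ha, hE, hG⟩ := exists_relative_spectrum hM hN h
    have key := sum_mul_log_le_of_sum_div_le hs hr (by rw [hc, ha, trace_ptrace2_s15])
      fun t ht => by
        obtain ⟨X, hX⟩ := (hF t ht).1
        rw [← hX, resolventForm_ptrace2]
        exact (hG t ht).2 ⟨_, rfl⟩
    have hlog := Real.log_pos one_lt_two
    nlinarith
  · rw [relent, relent, if_neg h]
    exact le_top

end PartialTrace

section Marginals

variable {d e : Type*} [Fintype d] [DecidableEq d] [Fintype e] [DecidableEq e]

omit [Fintype d] [DecidableEq d] [DecidableEq e] in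
lemma Matrix.PosSemidef.ptrace2 {M : Matrix (d × e) (d × e) ℂ} (hM : M.PosSemidef) :
    (ptrace2 M).PosSemidef := by
  have h : _root_.ptrace2 M = ∑ k, M.submatrix (fun i => (i, k)) (fun i => (i, k)) := by
    ext i j
    simp [_root_.ptrace2, Matrix.sum_apply]
  rw [h]
  exact posSemidef_sum _ fun k _ => hM.submatrix _

omit [Fintype e] [DecidableEq d] [DecidableEq e] in
lemma Matrix.PosSemidef.ptrace1 {M : Matrix (d × e) (d × e) ℂ} (hM : M.PosSemidef) :
    (ptrace1 M).PosSemidef := by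
  have h : _root_.ptrace1 M = ∑ k, M.submatrix (fun i => (k, i)) (fun i => (k, i)) := by
    ext i j
    simp [_root_.ptrace1, Matrix.sum_apply]
  rw [h]
  exact posSemidef_sum _ fun k _ => hM.submatrix _

omit [DecidableEq d] [DecidableEq e] in
lemma trace_ptrace1 (M : Matrix (d × e) (d × e) ℂ) : (ptrace1 M).trace = M.trace := by
  simp only [trace, ptrace1, Fintype.sum_prod_type, diag_apply]
  exact Finset.sum_comm

omit [DecidableEq e] in
lemma ptrace1_one_kronecker_mul (X : Matrix e e ℂ) (M : Matrix (d × e) (d × e) ℂ) :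
    ptrace1 (((1 : Matrix d d ℂ) ⊗ₖ X) * M) = X * ptrace1 M := by
  ext i j
  simp only [ptrace1, Matrix.mul_apply, Fintype.sum_prod_type, kroneckerMap_apply, one_apply,
    Finset.mul_sum]
  simp [Finset.sum_comm (s := (Finset.univ : Finset d)) (t := (Finset.univ : Finset e))]

omit [DecidableEq e] in
lemma ptrace1_mul_one_kronecker (X : Matrix e e ℂ) (M : Matrix (d × e) (d × e) ℂ) :
    ptrace1 (M * ((1 : Matrix d d ℂ) ⊗ₖ X)) = ptrace1 M * X := by
  ext i j
  simp only [ptrace1, Matrix.mul_apply, Fintype.sum_prod_type, kroneckerMap_apply, one_apply,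
    Finset.sum_mul]
  simp [Finset.sum_comm (s := (Finset.univ : Finset d)) (t := (Finset.univ : Finset e))]

omit [DecidableEq e] in
lemma ptrace2_one_kronecker_mul_comm (X : Matrix e e ℂ) (M : Matrix (d × e) (d × e) ℂ) :
    ptrace2 (((1 : Matrix d d ℂ) ⊗ₖ X) * M) = ptrace2 (M * ((1 : Matrix d d ℂ) ⊗ₖ X)) := by
  ext i j
  simp only [ptrace2, Matrix.mul_apply, Fintype.sum_prod_type, kroneckerMap_apply, one_apply]
  simp only [Finset.sum_comm (s := (Finset.univ : Finset e)) (t := (Finset.univ : Finset d))]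
  simp only [ite_mul, mul_ite, one_mul, zero_mul, mul_zero, Finset.sum_ite_irrel,
    Finset.sum_const_zero, Finset.sum_ite_eq, Finset.sum_ite_eq', Finset.mem_univ, if_true]
  rw [Finset.sum_comm]
  simp only [mul_comm]

omit [DecidableEq d] in
lemma ptrace1_kronecker_one_mul_comm (X : Matrix d d ℂ) (M : Matrix (d × e) (d × e) ℂ) :
    ptrace1 ((X ⊗ₖ (1 : Matrix e e ℂ)) * M) = ptrace1 (M * (X ⊗ₖ (1 : Matrix e e ℂ))) := by
  ext i j
  simp only [ptrace1, Matrix.mul_apply, Fintype.sum_prod_type, kroneckerMap_apply, one_apply]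
  rw [Finset.sum_comm]
  simp [mul_comm]

omit [Fintype d] [DecidableEq d] [DecidableEq e] in
lemma ptrace2_kronecker (A : Matrix d d ℂ) (B : Matrix e e ℂ) :
    ptrace2 (A ⊗ₖ B) = B.trace • A := by
  ext i j
  simp [ptrace2, trace, ← Finset.mul_sum, mul_comm]

omit [Fintype e] [DecidableEq d] [DecidableEq e] in
lemma ptrace1_kronecker (A : Matrix d d ℂ) (B : Matrix e e ℂ) :
    ptrace1 (A ⊗ₖ B) = A.trace • B := by
  ext i j
  simp [ptrace1, trace, ← Finset.sum_mul]

lemma ptrace2_conj_kronecker {V : Matrix d d ℂ} {U : Matrix e e ℂ} (hU : U * Uᴴ = 1)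
    (M : Matrix (d × e) (d × e) ℂ) :
    ptrace2 ((V ⊗ₖ U)ᴴ * M * (V ⊗ₖ U)) = Vᴴ * ptrace2 M * V := by
  have h1 : (V ⊗ₖ U)ᴴ = (Vᴴ ⊗ₖ (1 : Matrix e e ℂ)) * ((1 : Matrix d d ℂ) ⊗ₖ Uᴴ) := by
    rw [conjTranspose_kronecker, ← mul_kronecker_mul, Matrix.mul_one, Matrix.one_mul]
  have h2 : V ⊗ₖ U = ((1 : Matrix d d ℂ) ⊗ₖ U) * (V ⊗ₖ (1 : Matrix e e ℂ)) := by
    rw [← mul_kronecker_mul, Matrix.mul_one, Matrix.one_mul]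
  rw [h1, h2, ← Matrix.mul_assoc, ptrace2_mul_kronecker_one, Matrix.mul_assoc, Matrix.mul_assoc,
    ptrace2_kronecker_one_mul, ptrace2_one_kronecker_mul_comm, Matrix.mul_assoc,
    Matrix.mul_assoc M, ← mul_kronecker_mul, hU, Matrix.mul_one, one_kronecker_one, Matrix.mul_one,
    Matrix.mul_assoc]

lemma ptrace1_conj_kronecker {V : Matrix d d ℂ} {U : Matrix e e ℂ} (hV : V * Vᴴ = 1)
    (M : Matrix (d × e) (d × e) ℂ) :
    ptrace1 ((V ⊗ₖ U)ᴴ * M * (V ⊗ₖ U)) = Uᴴ * ptrace1 M * U := by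
  have h1 : (V ⊗ₖ U)ᴴ = ((1 : Matrix d d ℂ) ⊗ₖ Uᴴ) * (Vᴴ ⊗ₖ (1 : Matrix e e ℂ)) := by
    rw [conjTranspose_kronecker, ← mul_kronecker_mul, Matrix.mul_one, Matrix.one_mul]
  have h2 : V ⊗ₖ U = (V ⊗ₖ (1 : Matrix e e ℂ)) * ((1 : Matrix d d ℂ) ⊗ₖ U) := by
    rw [← mul_kronecker_mul, Matrix.mul_one, Matrix.one_mul]
  rw [h1, h2, ← Matrix.mul_assoc, ptrace1_mul_one_kronecker, Matrix.mul_assoc, Matrix.mul_assoc,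
    ptrace1_one_kronecker_mul, ptrace1_kronecker_one_mul_comm, Matrix.mul_assoc,
    Matrix.mul_assoc M, ← mul_kronecker_mul, hV, Matrix.mul_one, one_kronecker_one, Matrix.mul_one,
    Matrix.mul_assoc]

/-- In the product of the eigenbases of its marginals, a bipartite state is a classical joint
distribution of the two families of eigenvalues. -/
lemma exists_marginal_eigenbasis {ρ : Matrix (d × e) (d × e) ℂ} (hρ : ρ.PosSemidef) :
    ∃ (W : Matrix (d × e) (d × e) ℂ) (w : d → e → ℝ) (a : d → ℝ) (b : e → ℝ),
      Wᴴ * W = 1 ∧ W * Wᴴ = 1 ∧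
      ptrace2 ρ ⊗ₖ ptrace1 ρ =
        W * diagonal (fun k : d × e => ((a k.1 * b k.2 : ℝ) : ℂ)) * Wᴴ ∧
      (∀ i j, (Wᴴ * ρ * W) (i, j) (i, j) = w i j) ∧
      (∀ i j, w i j ≠ 0 → a i ≠ 0 ∧ b j ≠ 0) ∧
      (∀ i, ∑ j, w i j = a i) ∧ (∀ j, ∑ i, w i j = b j) ∧
      vnEntropy (ptrace2 ρ) = -∑ i, a i * Real.logb 2 (a i) ∧
      vnEntropy (ptrace1 ρ) = -∑ j, b j * Real.logb 2 (b j) := by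
  obtain ⟨V, a, hV, hV', -, hA⟩ := hρ.ptrace2.exists_eq_conj_diagonal
  obtain ⟨U, b, hU, hU', -, hB⟩ := hρ.ptrace1.exists_eq_conj_diagonal
  have hW : (V ⊗ₖ U)ᴴ * (V ⊗ₖ U) = 1 := by
    rw [conjTranspose_kronecker, ← mul_kronecker_mul, hV, hU, one_kronecker_one]
  have hW' : (V ⊗ₖ U) * (V ⊗ₖ U)ᴴ = 1 := by
    rw [conjTranspose_kronecker, ← mul_kronecker_mul, hV', hU', one_kronecker_one]
  have hw := hρ.conjTranspose_mul_mul_same (V ⊗ₖ U)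
  have hnn (i : d) (j : e) : 0 ≤ (((V ⊗ₖ U)ᴴ * ρ * (V ⊗ₖ U)) (i, j) (i, j)).re :=
    (Complex.nonneg_iff.mp (hw.diag_nonneg (i := (i, j)))).1
  have hrow (i : d) : ∑ j, (((V ⊗ₖ U)ᴴ * ρ * (V ⊗ₖ U)) (i, j) (i, j)).re = a i := by
    have h := congrArg Complex.re (congrFun (congrFun (ptrace2_conj_kronecker (V := V) hU' ρ) i) i)
    rw [hA, conj_conj_diagonal hV] at h
    simpa [ptrace2] using h
  have hcol (j : e) : ∑ i, (((V ⊗ₖ U)ᴴ * ρ * (V ⊗ₖ U)) (i, j) (i, j)).re = b j := by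
    have h := congrArg Complex.re (congrFun (congrFun (ptrace1_conj_kronecker (U := U) hV' ρ) j) j)
    rw [hB, conj_conj_diagonal hU] at h
    simpa [ptrace1] using h
  refine ⟨V ⊗ₖ U, fun i j => (((V ⊗ₖ U)ᴴ * ρ * (V ⊗ₖ U)) (i, j) (i, j)).re, a, b, hW, hW',
    ?_, fun i j => ?_, fun i j hij => ⟨fun h0 => ?_, fun h0 => ?_⟩, hrow, hcol, ?_, ?_⟩
  · rw [hA, hB, mul_kronecker_mul, mul_kronecker_mul, conjTranspose_kronecker,
      diagonal_kronecker_diagonal]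
    simp
  · exact (hw.1.coe_re_apply_self (i, j)).symm
  · rw [← hrow i, Finset.sum_eq_zero_iff_of_nonneg fun j _ => hnn i j] at h0
    exact hij (h0 j (Finset.mem_univ _))
  · rw [← hcol j, Finset.sum_eq_zero_iff_of_nonneg fun i _ => hnn i j] at h0
    exact hij (h0 i (Finset.mem_univ _))
  · rw [hA, vnEntropy_conj_diagonal hV hV']
  · rw [hB, vnEntropy_conj_diagonal hU hU']

lemma supportLE_ptrace_kronecker {ρ : Matrix (d × e) (d × e) ℂ} (hρ : ρ.PosSemidef) :
    SupportLE ρ (ptrace2 ρ ⊗ₖ ptrace1 ρ) := by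
  obtain ⟨W, w, a, b, hW, hW', hab, hw, hne, -⟩ := exists_marginal_eigenbasis hρ
  rw [hab, supportLE_conj_diagonal_iff hρ hW hW']
  rintro ⟨i, j⟩ hk
  rw [hw]
  by_contra h0
  have h1 := hne i j (by exact_mod_cast h0)
  exact mul_ne_zero h1.1 h1.2 hk

lemma relentR_ptrace_kronecker {ρ : Matrix (d × e) (d × e) ℂ} (hρ : ρ.PosSemidef) :
    relentR ρ (ptrace2 ρ ⊗ₖ ptrace1 ρ) =
      vnEntropy (ptrace2 ρ) + vnEntropy (ptrace1 ρ) - vnEntropy ρ := by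
  obtain ⟨W, w, a, b, hW, hW', hab, hw, hne, hrow, hcol, ha, hb⟩ := exists_marginal_eigenbasis hρ
  have h : ∑ k : d × e, ((Wᴴ * ρ * W) k k).re * Real.logb 2 (a k.1 * b k.2) =
      ∑ i, a i * Real.logb 2 (a i) + ∑ j, b j * Real.logb 2 (b j) := by
    calc _ = ∑ i, ∑ j, (w i j * Real.logb 2 (a i) + w i j * Real.logb 2 (b j)) := by
          rw [Fintype.sum_prod_type]
          refine Finset.sum_congr rfl fun i _ => Finset.sum_congr rfl fun j _ => ?_
          rw [hw, Complex.ofReal_re]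
          by_cases h0 : w i j = 0
          · simp [h0]
          · rw [Real.logb_mul (hne i j h0).1 (hne i j h0).2, mul_add]
      _ = _ := by
          simp only [Finset.sum_add_distrib]
          congr 1
          · simp only [← Finset.sum_mul, hrow]
          · rw [Finset.sum_comm]
            simp only [← Finset.sum_mul, hcol]
  rw [relentR, Complex.sub_re, hab, trace_mul_matLog2_conj_diagonal ρ hW hW', h, ha, hb, vnEntropy]
  ring

lemma vnEntropy_kronecker {A : Matrix d d ℂ} {B : Matrix e e ℂ} (hA : IsDensityMatrix A)
    (hB : IsDensityMatrix B) : vnEntropy (A ⊗ₖ B) = vnEntropy A + vnEntropy B := by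
  have h := relentR_ptrace_kronecker (hA.1.kronecker hB.1)
  rw [ptrace2_kronecker, ptrace1_kronecker, hA.2, hB.2, one_smul, one_smul, relentR, sub_self,
    Complex.zero_re] at h
  linarith

end Marginals

section Recovery

variable {R B C T : Type} [Fintype R] [Fintype B] [Fintype C] [Fintype T]
  [DecidableEq R] [DecidableEq B] [DecidableEq C] [DecidableEq T]

/-- Kraus operator (indexed by a column of `S`) appending the state `S * Sᴴ` on `C × T`. -/
def appendKraus {m : Type} (B : Type) [DecidableEq B] (S : Matrix (C × T) m ℂ) (k : m) :
    Matrix ((B × C) × T) B ℂ :=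
  fun x b => if x.1.1 = b then S (x.1.2, x.2) k else 0

/-- Kraus operator (indexed by a basis vector of `T`) discarding the factor `T`. -/
def discardKraus (D : Type) [DecidableEq D] (t : T) : Matrix D (D × T) ℂ :=
  fun x y => if y = (x, t) then 1 else 0

omit [Fintype R] [Fintype C] [Fintype T] [DecidableEq C] [DecidableEq T] in
lemma sum_appendKraus_conj {m : Type} [Fintype m] (S : Matrix (C × T) m ℂ)
    [Fintype R] (X : Matrix (R × B) (R × B) ℂ) :
    ∑ k, ((1 : Matrix R R ℂ) ⊗ₖ appendKraus B S k) * X * ((1 : Matrix R R ℂ) ⊗ₖ appendKraus B S k)ᴴ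
      = reindex (eRBCT R B C T) (eRBCT R B C T) (X ⊗ₖ (S * Sᴴ)) := by
  ext ⟨r, ⟨b, c⟩, t⟩ ⟨r', ⟨b', c'⟩, t'⟩
  simp [Matrix.sum_apply, Matrix.mul_apply, appendKraus, Fintype.sum_prod_type, one_apply, eRBCT,
    Finset.mul_sum, apply_ite (starRingEnd ℂ)]
  refine Finset.sum_congr rfl fun k _ => ?_
  ring

omit [Fintype C] [Fintype B] [DecidableEq C] [DecidableEq B] in
lemma sum_discardKraus_conj {D : Type} [Fintype D] [DecidableEq D]
    (M : Matrix (R × (D × T)) (R × (D × T)) ℂ) :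
    ∑ t : T, ((1 : Matrix R R ℂ) ⊗ₖ discardKraus D t) * M *
        ((1 : Matrix R R ℂ) ⊗ₖ discardKraus D t)ᴴ =
      ptrace2 (reindex (Equiv.prodAssoc R D T).symm (Equiv.prodAssoc R D T).symm M) := by
  ext ⟨r, x⟩ ⟨r', x'⟩
  simp [Matrix.sum_apply, Matrix.mul_apply, discardKraus, Fintype.sum_prod_type, one_apply,
    ptrace2, apply_ite (starRingEnd ℂ)]

omit [DecidableEq C] [DecidableEq T] in
lemma sum_conj_appendKraus {m : Type} [Fintype m] (S : Matrix (C × T) m ℂ) :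
    ∑ k, (appendKraus B S k)ᴴ * appendKraus B S k = (S * Sᴴ).trace • (1 : Matrix B B ℂ) := by
  ext b b'
  simp [Matrix.sum_apply, Matrix.mul_apply, appendKraus, Fintype.sum_prod_type, one_apply, trace,
    apply_ite (starRingEnd ℂ)]
  by_cases h : b = b'
  · rw [if_pos h, if_pos h.symm, Finset.sum_comm]
    refine Finset.sum_congr rfl fun x _ => ?_
    rw [Finset.sum_comm]
    simp only [mul_comm]
  · rw [if_neg h, if_neg (Ne.symm h)]

lemma sum_conj_discardKraus {D : Type} [Fintype D] [DecidableEq D] :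
    ∑ t : T, (discardKraus D t)ᴴ * discardKraus D t = (1 : Matrix (D × T) (D × T) ℂ) := by
  ext ⟨x, t⟩ ⟨x', t'⟩
  simp [Matrix.sum_apply, Matrix.mul_apply, discardKraus, one_apply, Prod.mk.injEq, ite_and,
    apply_ite (starRingEnd ℂ)]

/-- Appending a state `τ` on `C × T`, applying an isometry on `B × C × T` and discarding `T` is
a quantum channel from `B` to `B × C`. -/
lemma exists_kraus_append_conj_discard [Nonempty C] [Nonempty T]
    {U : Matrix ((B × C) × T) ((B × C) × T) ℂ} (hU : Uᴴ * U = 1)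
    {τ : Matrix (C × T) (C × T) ℂ} (hτ : IsDensityMatrix τ) :
    ∃ (ι : FinIdx) (K : ι.carrier → Matrix (B × C) B ℂ), (∑ i, (K i)ᴴ * K i) = 1 ∧
      ∀ X : Matrix (R × B) (R × B) ℂ, applyChannelR K X =
        ptrace2 (reindex (Equiv.prodAssoc R (B × C) T).symm (Equiv.prodAssoc R (B × C) T).symm
          (((1 : Matrix R R ℂ) ⊗ₖ U) * reindex (eRBCT R B C T) (eRBCT R B C T) (X ⊗ₖ τ) *
            ((1 : Matrix R R ℂ) ⊗ₖ Uᴴ))) := by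
  obtain ⟨S, rfl⟩ : ∃ S : Matrix (C × T) (C × T) ℂ, τ = S * Sᴴ := by
    obtain ⟨V, a, -, -, ha, h⟩ := hτ.1.exists_eq_conj_diagonal
    refine ⟨V * diagonal (fun i => (Real.sqrt (a i) : ℂ)), ?_⟩
    rw [h, conjTranspose_mul, diagonal_conjTranspose, Matrix.mul_assoc, Matrix.mul_assoc,
      ← Matrix.mul_assoc (diagonal _) (diagonal _), diagonal_mul_diagonal]
    congr 3
    ext i : 1
    simp [← Complex.ofReal_mul, Real.mul_self_sqrt (ha i)]
  refine ⟨⟨T × (C × T)⟩, fun k => discardKraus (B × C) k.1 * U * appendKraus B S k.2, ?_,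
    fun X => ?_⟩
  · calc ∑ k : T × (C × T), (discardKraus (B × C) k.1 * U * appendKraus B S k.2)ᴴ *
          (discardKraus (B × C) k.1 * U * appendKraus B S k.2)
        = ∑ k, (appendKraus B S k)ᴴ * (Uᴴ * (∑ t : T, (discardKraus (B × C) t)ᴴ *
            discardKraus (B × C) t) * U) * appendKraus B S k := by
          rw [Fintype.sum_prod_type, Finset.sum_comm]
          refine Finset.sum_congr rfl fun k _ => ?_
          simp only [Matrix.mul_sum, Matrix.sum_mul, conjTranspose_mul, Matrix.mul_assoc]
      _ = 1 := by
          rw [sum_conj_discardKraus, Matrix.mul_one, hU]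
          simp only [Matrix.mul_one]
          rw [sum_conj_appendKraus, hτ.2, one_smul]
  · rw [← sum_appendKraus_conj, ← sum_discardKraus_conj, applyChannelR]
    have hsplit (k : T × (C × T)) :
        (1 : Matrix R R ℂ) ⊗ₖ (discardKraus (B × C) k.1 * U * appendKraus B S k.2) =
          ((1 : Matrix R R ℂ) ⊗ₖ discardKraus (B × C) k.1) * ((1 : Matrix R R ℂ) ⊗ₖ U) *
            ((1 : Matrix R R ℂ) ⊗ₖ appendKraus B S k.2) := by
      rw [← mul_kronecker_mul, ← mul_kronecker_mul, Matrix.one_mul, Matrix.one_mul]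
    have hUc : ((1 : Matrix R R ℂ) ⊗ₖ U)ᴴ = (1 : Matrix R R ℂ) ⊗ₖ Uᴴ := by
      rw [conjTranspose_kronecker, conjTranspose_one]
    simp only [hsplit, conjTranspose_mul, hUc]
    refine (Fintype.sum_prod_type _).trans (Finset.sum_congr rfl fun t _ => ?_)
    simp only [Matrix.mul_sum, Matrix.sum_mul, Matrix.mul_assoc]

omit [DecidableEq R] [DecidableEq B] [DecidableEq C] [DecidableEq T] [Fintype R] [Fintype B]
  [Fintype C] [Fintype T] in
lemma Matrix.PosSemidef.reindex {d n : Type*} {A : Matrix d d ℂ} (hA : A.PosSemidef)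
    (f : d ≃ n) : (reindex f f A).PosSemidef :=
  hA.submatrix f.symm

/-- The recovery bound for a fixed decoupling unitary. -/
lemma iInf_relent_recovery_le [Nonempty C] {Ψ : Matrix (R × (B × C)) (R × (B × C)) ℂ}
    (hΨ : IsDensityMatrix Ψ) (T : FinIdx) {σ' : Matrix T.carrier T.carrier ℂ}
    (hσ' : IsDensityMatrix σ') {U : Matrix ((B × C) × T.carrier) ((B × C) × T.carrier) ℂ}
    (hU : Uᴴ * U = 1) (hU' : U * Uᴴ = 1)
    (hγ : ptrace2 (reindex (eRBCT R B C T.carrier).symm (eRBCT R B C T.carrier).symm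
      (gammaState T Ψ σ' U)) = margRB Ψ) :
    (⨅ (ι : FinIdx) (K : ι.carrier → Matrix (B × C) B ℂ) (_ : (∑ i, (K i)ᴴ * K i) = 1),
        relent Ψ (applyChannelR K (margRB Ψ))) ≤
      ((vnEntropy (margRB Ψ) + vnEntropy (ptrace1 Ψ) - vnEntropy Ψ
        - vnEntropy (ptrace2 (ptrace1 Ψ)) : ℝ) : EReal)
      + mutInfo (reindex (Equiv.prodAssoc B C T.carrier) (Equiv.prodAssoc B C T.carrier)
          (ptrace1 (gammaState T Ψ σ' U))) := by
  set e := eRBCT R B C T.carrier with he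
  set f := Equiv.prodAssoc R (B × C) T.carrier with hf
  set W : Matrix (R × ((B × C) × T.carrier)) (R × ((B × C) × T.carrier)) ℂ :=
    (1 : Matrix R R ℂ) ⊗ₖ U with hW
  have hWc : Wᴴ = (1 : Matrix R R ℂ) ⊗ₖ Uᴴ := by
    rw [hW, conjTranspose_kronecker, conjTranspose_one]
  have hWW : Wᴴ * W = 1 := by
    rw [hWc, hW, ← mul_kronecker_mul, hU, Matrix.one_mul, one_kronecker_one]
  have hWW' : W * Wᴴ = 1 := by
    rw [hWc, hW, ← mul_kronecker_mul, hU', Matrix.one_mul, one_kronecker_one]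
  set γ := gammaState T Ψ σ' U with hγdef
  have hγW : γ = Wᴴ * reindex f f (Ψ ⊗ₖ σ') * Wᴴᴴ := by
    rw [conjTranspose_conjTranspose, hWc]; rfl
  have hΨσ : (Ψ ⊗ₖ σ').PosSemidef := hΨ.1.kronecker hσ'.1
  have hγpos : γ.PosSemidef := by
    rw [hγW]; exact (hΨσ.reindex f).mul_mul_conjTranspose_same _
  have hSγ : vnEntropy γ = vnEntropy Ψ + vnEntropy σ' := by
    rw [hγW, vnEntropy_conj (by rwa [conjTranspose_conjTranspose])
      (by rwa [conjTranspose_conjTranspose]) (hΨσ.reindex f).1, vnEntropy_reindex _ hΨσ.1,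
      vnEntropy_kronecker hΨ hσ']
  have htr : γ.trace = 1 := by
    rw [hγW, trace_mul_comm, ← Matrix.mul_assoc, conjTranspose_conjTranspose, hWW',
      Matrix.one_mul, trace, reindex_apply]
    simp only [diag_apply, submatrix_apply]
    rw [Equiv.sum_comp f.symm fun i => (Ψ ⊗ₖ σ') i i]
    have := trace_kronecker Ψ σ'
    rwa [hΨ.2, hσ'.2, mul_one] at this
  -- the state `γ` as a bipartite state of `R × B` and `C × T`
  set γ' := reindex e.symm e.symm γ with hγ'
  have hγ'pos : γ'.PosSemidef := hγpos.reindex e.symm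
  have hSγ' : vnEntropy γ' = vnEntropy Ψ + vnEntropy σ' := by
    rw [hγ', vnEntropy_reindex _ hγpos.1, hSγ]
  have hτ : IsDensityMatrix (ptrace1 γ') := by
    refine ⟨hγ'pos.ptrace1, ?_⟩
    rw [trace_ptrace1, ← htr, trace, trace, hγ', reindex_apply]
    simp only [diag_apply, submatrix_apply]
    exact Equiv.sum_comp e.symm.symm fun i => γ i i
  -- the state `γ` as a bipartite state of `B` and `C × T`
  set g := Equiv.prodAssoc B C T.carrier with hg
  set δ := reindex g g (ptrace1 γ) with hδ
  have hδpos : δ.PosSemidef := hγpos.ptrace1.reindex g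
  have hΨBC : IsDensityMatrix (ptrace1 Ψ) := ⟨hΨ.1.ptrace1, by rw [trace_ptrace1, hΨ.2]⟩
  have hSδ : vnEntropy δ = vnEntropy (ptrace1 Ψ) + vnEntropy σ' := by
    have h1 : ptrace1 (reindex f f (Ψ ⊗ₖ σ')) = ptrace1 Ψ ⊗ₖ σ' := by
      ext ⟨x, t⟩ ⟨x', t'⟩
      simp [ptrace1, hf, Finset.sum_mul]
    have h2 : ptrace1 γ = Uᴴ * (ptrace1 Ψ ⊗ₖ σ') * Uᴴᴴ := by
      rw [hγW, conjTranspose_conjTranspose, hWc, hW, ptrace1_mul_one_kronecker,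
        ptrace1_one_kronecker_mul, h1, conjTranspose_conjTranspose]
    rw [hδ, vnEntropy_reindex _ hγpos.ptrace1.1, h2,
      vnEntropy_conj (by rwa [conjTranspose_conjTranspose])
      (by rwa [conjTranspose_conjTranspose]) (hΨBC.1.kronecker hσ'.1).1,
      vnEntropy_kronecker hΨBC hσ']
  have hδ1 : ptrace1 δ = ptrace1 γ' := by
    ext ⟨c, t⟩ ⟨c', t'⟩
    simp only [hδ, hγ', ptrace1, reindex_apply, submatrix_apply, Fintype.sum_prod_type]
    exact Finset.sum_comm
  have hδ2 : ptrace2 δ = ptrace2 (ptrace1 Ψ) := by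
    have h1 : ptrace2 δ = ptrace1 (ptrace2 γ') := by
      ext b b'
      simp only [hδ, hγ', ptrace1, ptrace2, reindex_apply, submatrix_apply]
      exact Finset.sum_comm
    rw [h1, hγ]
    ext b b'
    simp only [margRB, ptrace1, ptrace2, reindex_apply, submatrix_apply]
    exact Finset.sum_comm
  obtain ⟨ι, K, hK, hKX⟩ := exists_kraus_append_conj_discard (R := R) hU hτ
  have hmut : mutInfo δ = ((vnEntropy (ptrace2 (ptrace1 Ψ)) + vnEntropy (ptrace1 γ') -
      (vnEntropy (ptrace1 Ψ) + vnEntropy σ') : ℝ) : EReal) := by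
    rw [mutInfo, relent, if_pos (supportLE_ptrace_kronecker hδpos), relentR_ptrace_kronecker hδpos,
      hδ1, hδ2, hSδ]
  refine iInf_le_of_le ι (iInf_le_of_le K (iInf_le_of_le hK ?_))
  rw [hmut, ← EReal.coe_add]
  have hprod : (ptrace2 γ' ⊗ₖ ptrace1 γ').PosSemidef := hγ'pos.ptrace2.kronecker hγ'pos.ptrace1
  have hN : (W * reindex e e (ptrace2 γ' ⊗ₖ ptrace1 γ') * Wᴴ).PosSemidef :=
    (hprod.reindex e).mul_mul_conjTranspose_same W
  have hN' := hN.reindex f.symm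
  have hout : applyChannelR K (margRB Ψ) = ptrace2 (reindex f.symm f.symm
      (W * reindex e e (ptrace2 γ' ⊗ₖ ptrace1 γ') * Wᴴ)) := by
    rw [hKX, hγ, hWc]
  have hγe : reindex e e γ' = γ := by
    ext i j
    simp [hγ']
  have hin : Ψ ⊗ₖ σ' = reindex f.symm f.symm (W * reindex e e γ' * Wᴴ) := by
    have h1 : W * γ * Wᴴ = reindex f f (Ψ ⊗ₖ σ') := by
      rw [hγW, conjTranspose_conjTranspose,
        show W * (Wᴴ * reindex f f (Ψ ⊗ₖ σ') * W) * Wᴴ =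
          (W * Wᴴ) * reindex f f (Ψ ⊗ₖ σ') * (W * Wᴴ) by simp only [Matrix.mul_assoc],
        hWW', Matrix.one_mul, Matrix.mul_one]
    rw [hγe, h1]
    ext i j
    simp
  have hpt : ptrace2 (Ψ ⊗ₖ σ') = Ψ := by rw [ptrace2_kronecker, hσ'.2, one_smul]
  calc relent Ψ (applyChannelR K (margRB Ψ))
      = relent (ptrace2 (Ψ ⊗ₖ σ')) (ptrace2 (reindex f.symm f.symm
          (W * reindex e e (ptrace2 γ' ⊗ₖ ptrace1 γ') * Wᴴ))) := by rw [hpt, hout]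
    _ ≤ relent (Ψ ⊗ₖ σ') (reindex f.symm f.symm
          (W * reindex e e (ptrace2 γ' ⊗ₖ ptrace1 γ') * Wᴴ)) :=
        relent_ptrace2_le hΨσ hN' hΨσ.ptrace2 hN'.ptrace2
    _ = relent γ' (ptrace2 γ' ⊗ₖ ptrace1 γ') := by
        rw [hin, relent_reindex _ (by
            rw [hγe]; exact (hγpos.mul_mul_conjTranspose_same W).1) hN.1,
          relent_conj hWW hWW' (hγ'pos.reindex e).1 (hprod.reindex e).1,
          relent_reindex _ hγ'pos.1 hprod.1]
    _ = ((vnEntropy (margRB Ψ) + vnEntropy (ptrace1 γ') - (vnEntropy Ψ + vnEntropy σ') : ℝ) :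
          EReal) := by
        rw [relent, if_pos (supportLE_ptrace_kronecker hγ'pos),
          relentR_ptrace_kronecker hγ'pos, hγ, hSγ']
    _ ≤ _ := by
        rw [EReal.coe_le_coe_iff]
        linarith

end Recovery

/-- The infimum over recovery channels `E : B → B×C` of `D(Ψ_RBC ‖ (id_R ⊗ E)(Ψ_RB))`
is at most `I(R:C|B)_Ψ` plus the best achievable decoupling `inf I(B:CT)_γ` over
ancillas `T`, states `σ'_T` and unitaries `U` on `B×C×T` with
`γ = (I⊗U†)(Ψ_RBC ⊗ σ'_T)(I⊗U)` satisfying `γ_RB = Ψ_RB`. -/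
theorem recovery_relent_le {R A B C : Type}
    [Fintype R] [Fintype A] [Fintype B] [Fintype C]
    [DecidableEq R] [DecidableEq A] [DecidableEq B] [DecidableEq C]
    [Nonempty R] [Nonempty A] [Nonempty B] [Nonempty C]
    (ψ : (R × (B × C)) × A → ℂ) (hψ : ∑ i, ‖ψ i‖ ^ 2 = 1) :
    (⨅ (ι : FinIdx) (K : ι.carrier → Matrix (B × C) B ℂ)
        (_ : (∑ i, (K i)ᴴ * K i) = 1),
        relent (ptrace2 (Matrix.vecMulVec ψ (star ψ)))
          (applyChannelR K (margRB (ptrace2 (Matrix.vecMulVec ψ (star ψ)))))) ≤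
      ((vnEntropy (margRB (ptrace2 (Matrix.vecMulVec ψ (star ψ))))
          + vnEntropy (ptrace1 (ptrace2 (Matrix.vecMulVec ψ (star ψ))))
          - vnEntropy (ptrace2 (Matrix.vecMulVec ψ (star ψ)))
          - vnEntropy (ptrace2 (ptrace1 (ptrace2 (Matrix.vecMulVec ψ (star ψ))))) : ℝ)
        : EReal)
      + ⨅ (T : FinIdx)
          (σ' : {m : Matrix T.carrier T.carrier ℂ // IsDensityMatrix m})
          (U : Matrix.unitaryGroup ((B × C) × T.carrier) ℂ)
          (_ : ptrace2
              (Matrix.reindex (eRBCT R B C T.carrier).symm (eRBCT R B C T.carrier).symm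
                (gammaState T (ptrace2 (Matrix.vecMulVec ψ (star ψ))) σ'.1 U.1)) =
            margRB (ptrace2 (Matrix.vecMulVec ψ (star ψ)))),
          mutInfo
            (Matrix.reindex (Equiv.prodAssoc B C T.carrier) (Equiv.prodAssoc B C T.carrier)
              (ptrace1
                (gammaState T (ptrace2 (Matrix.vecMulVec ψ (star ψ))) σ'.1 U.1))) := by
  have hΨ : IsDensityMatrix (ptrace2 (Matrix.vecMulVec ψ (star ψ))) := by
    refine ⟨(posSemidef_vecMulVec_self_star ψ).ptrace2, ?_⟩
    rw [trace_ptrace2_s15, trace_vecMulVec, dotProduct]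
    simp only [Pi.star_apply, RCLike.star_def, Complex.mul_conj, Complex.normSq_eq_norm_sq]
    exact_mod_cast hψ
  rw [add_comm, ← EReal.sub_le_iff_le_add (.inl (EReal.coe_ne_bot _)) (.inl (EReal.coe_ne_top _))]
  refine le_iInf fun T => le_iInf fun σ' => le_iInf fun U => le_iInf fun hγ => ?_
  rw [EReal.sub_le_iff_le_add (.inl (EReal.coe_ne_bot _)) (.inl (EReal.coe_ne_top _)), add_comm]
  exact iInf_relent_recovery_le hΨ T σ'.2 (mem_unitaryGroup_iff'.mp U.2)
    (mem_unitaryGroup_iff.mp U.2) hγ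

end
end
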